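/- Let Ω be a germ at a point x₀ of a differential 2-form of rank 4 on a 4-dimensional manifold which is of type 1 (that is, the associated 1-form ω_Ω is nonzero at x₀ and of constant class 1 on a neighbourhood of x₀). Then there exists a local coordinate system (x¹,x²,x³,x⁴) centred at x₀ in which Ω = exp(x³) dx¹∧dx² + dx³∧dx⁴. -/

import Mathlib

/-!  Coordinate formalization of differential forms in four variables,
     following "The equivalence problem of differential 2-forms in 4 variables". -/

open Real Filter

/-- Points of `ℝ⁴`; the coordinates `x¹, x², x³, x⁴` of the paper are `x 0, x 1, x 2, x 3`. -/
abbrev Pt := Fin 4 → ℝ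

/-- Partial derivative `∂f/∂xⁱ`. -/
noncomputable def pd (i : Fin 4) (f : Pt → ℝ) (x : Pt) : ℝ :=
  fderiv ℝ f x (Pi.single i 1)

/-- Second partial derivative `∂²f/∂xⁱ∂xʲ`. -/
noncomputable def pd2 (i j : Fin 4) (f : Pt → ℝ) (x : Pt) : ℝ :=
  pd i (fun y => pd j f y) x

/-- Differential forms of degree 0,1,2,3,4 on `ℝ⁴`, given by their (skew-symmetric)
    coordinate components, and vector fields. -/
abbrev Form0 := Pt → ℝ
abbrev Form1 := Pt → Fin 4 → ℝ
abbrev Form2 := Pt → Fin 4 → Fin 4 → ℝ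
abbrev Form3 := Pt → Fin 4 → Fin 4 → Fin 4 → ℝ
abbrev Form4 := Pt → Fin 4 → Fin 4 → Fin 4 → Fin 4 → ℝ
abbrev Vec := Pt → Fin 4 → ℝ

/-- A 2-form has skew-symmetric components. -/
def Alt2 (B : Form2) : Prop := ∀ x i j, B x i j = - B x j i

/-- Exterior derivative of a function. -/
noncomputable def d0 (f : Form0) : Form1 := fun x i => pd i f x

/-- Exterior derivative of a 1-form. -/
noncomputable def d1 (ω : Form1) : Form2 := fun x i j =>
  pd i (fun y => ω y j) x - pd j (fun y => ω y i) x

/-- Exterior derivative of a 2-form. -/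
noncomputable def d2 (B : Form2) : Form3 := fun x i j k =>
  pd i (fun y => B y j k) x - pd j (fun y => B y i k) x + pd k (fun y => B y i j) x

/-- Wedge product of two 1-forms. -/
def w11 (ω η : Form1) : Form2 := fun x i j => ω x i * η x j - ω x j * η x i

/-- Wedge product of a 1-form and a 2-form. -/
def w12 (ω : Form1) (B : Form2) : Form3 := fun x i j k =>
  ω x i * B x j k - ω x j * B x i k + ω x k * B x i j

/-- Wedge product of a 1-form and a 3-form. -/
def w13 (ω : Form1) (C : Form3) : Form4 := fun x i j k l =>
  ω x i * C x j k l - ω x j * C x i k l + ω x k * C x i j l - ω x l * C x i j k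

/-- Wedge product of two 2-forms. -/
def w22 (A B : Form2) : Form4 := fun x i j k l =>
  A x i j * B x k l - A x i k * B x j l + A x i l * B x j k
    + A x j k * B x i l - A x j l * B x i k + A x k l * B x i j

/-- A 2-form is of rank 4 when `Ω ∧ Ω` vanishes nowhere. -/
def Rank4 (B : Form2) : Prop := ∀ x, w22 B B x ≠ 0

/-- Interior products `i_X`. -/
def i1 (X : Vec) (ω : Form1) : Form0 := fun x => ∑ i, X x i * ω x i
def i2 (X : Vec) (B : Form2) : Form1 := fun x j => ∑ i, X x i * B x i j
def i3 (X : Vec) (C : Form3) : Form2 := fun x j k => ∑ i, X x i * C x i j k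
def i4 (X : Vec) (D : Form4) : Form3 := fun x j k l => ∑ i, X x i * D x i j k l

/-- Evaluation `B(X,Y)` of a 2-form on two vector fields. -/
def ev2 (B : Form2) (X Y : Vec) : Form0 := fun x => ∑ i, ∑ j, X x i * Y x j * B x i j

/-- Evaluation `D(X,Y,Z,W)` of a 4-form on four vector fields. -/
def ev4 (D : Form4) (X Y Z W : Vec) : Form0 := fun x =>
  ∑ i, ∑ j, ∑ k, ∑ l, X x i * Y x j * Z x k * W x l * D x i j k l

/-- Lie derivative of a 1-form (Cartan's magic formula). -/
noncomputable def lie1 (X : Vec) (ω : Form1) : Form1 := fun x i =>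
  d0 (i1 X ω) x i + i2 X (d1 ω) x i

/-- Lie derivative of a 2-form (Cartan's magic formula). -/
noncomputable def lie2 (X : Vec) (B : Form2) : Form2 := fun x i j =>
  d1 (i2 X B) x i j + i3 X (d2 B) x i j

/-- Lie bracket of two vector fields. -/
noncomputable def bracket (X Y : Vec) : Vec := fun x i =>
  ∑ j, (X x j * pd j (fun y => Y y i) x - Y x j * pd j (fun y => X y i) x)

/-- Derivative `X(f)` of a function along a vector field. -/
noncomputable def dirDeriv (X : Vec) (f : Form0) : Form0 := fun x => ∑ j, X x j * pd j f x

/-- Pullback of a 1-form under a smooth map. -/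
noncomputable def pull1 (φ : Pt → Pt) (ω : Form1) : Form1 := fun x i =>
  ∑ a, ω (φ x) a * pd i (fun y => φ y a) x

/-- Pullback of a 2-form under a smooth map. -/
noncomputable def pull2 (φ : Pt → Pt) (B : Form2) : Form2 := fun x i j =>
  ∑ a, ∑ b, B (φ x) a b * pd i (fun y => φ y a) x * pd j (fun y => φ y b) x

/-- A pair of mutually inverse smooth maps: a diffeomorphism of `ℝ⁴` (with inverse). -/
def IsDiffeo (φ ψ : Pt → Pt) : Prop :=
  ContDiff ℝ (⊤ : ℕ∞) φ ∧ ContDiff ℝ (⊤ : ℕ∞) ψ ∧ (∀ x, ψ (φ x) = x) ∧ (∀ x, φ (ψ x) = x)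

/-- The covector with components `c` as a linear functional on the tangent space `ℝ⁴`. -/
noncomputable def covec (c : Fin 4 → ℝ) : Pt →ₗ[ℝ] ℝ :=
  ∑ i, c i • (LinearMap.proj i : Pt →ₗ[ℝ] ℝ)

/-- The class of a 1-form `ω` at `x`: the codimension of the space of tangent vectors `v`
    with `i_v ω = 0` and `i_v (dω) = 0`. -/
noncomputable def classAt (ω : Form1) (x : Pt) : ℕ :=
  4 - Module.finrank ℝ
    ↥(LinearMap.ker (covec (ω x)) ⊓ ⨅ j, LinearMap.ker (covec (fun i => d1 ω x i j)))

/-- Components of the constant 2-form `dxᵃ ∧ dxᵇ`. -/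
def dxw (a b : Fin 4) : Fin 4 → Fin 4 → ℝ := fun i j =>
  (if i = a ∧ j = b then (1:ℝ) else 0) - (if i = b ∧ j = a then (1:ℝ) else 0)

/-- A germ of 2-form (with associated 1-form `ω = ω_Ω`) is of type `t` at `x₀`:
    `ω` is nonsingular at `x₀` and of constant class `t` near `x₀`. -/
def IsTypeAt (ω : Form1) (t : ℕ) (x₀ : Pt) : Prop :=
  ω x₀ ≠ 0 ∧ ∀ᶠ x in nhds x₀, classAt ω x = t

section helpers
open scoped Topology ContDiff

theorem exists_global_smooth {E F : Type} [NormedAddCommGroup E] [NormedSpace ℝ E]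
    [FiniteDimensional ℝ E] [NormedAddCommGroup F] [NormedSpace ℝ F]
    {f : E → F} {W : Set E} {x₀ : E} (hW : W ∈ 𝓝 x₀) (hf : ContDiffOn ℝ ∞ f W) :
    ∃ g : E → F, ContDiff ℝ ∞ g ∧ ∀ᶠ x in 𝓝 x₀, g x = f x := by
  obtain ⟨r, hr, hrW⟩ := Metric.mem_nhds_iff.1 hW
  let b : ContDiffBump x₀ := ⟨r / 4, r / 2, by positivity, by linarith⟩
  refine ⟨fun x => b x • f x, ?_, ?_⟩
  · rw [contDiff_iff_contDiffAt]
    intro x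
    by_cases hx : x ∈ Metric.ball x₀ r
    · exact b.contDiff.contDiffAt.smul
        ((hf x (hrW hx)).contDiffAt (mem_of_superset (Metric.isOpen_ball.mem_nhds hx) hrW))
    · have hx' : x ∈ (Metric.closedBall x₀ (r / 2))ᶜ := by
        simp only [Metric.mem_ball, not_lt, Set.mem_compl_iff, Metric.mem_closedBall, not_le] at hx ⊢
        linarith
      have : (fun x => b x • f x) =ᶠ[𝓝 x] fun _ => 0 := by
        filter_upwards [Metric.isClosed_closedBall.isOpen_compl.mem_nhds hx'] with y hy
        have : b y = 0 := b.zero_of_le_dist (by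
          simp only [Set.mem_compl_iff, Metric.mem_closedBall, not_le] at hy
          exact hy.le)
        simp [this]
      exact contDiffAt_const.congr_of_eventuallyEq this
  · filter_upwards [b.eventuallyEq_one] with x hx
    simp [hx]

theorem smooth_inverse {E F : Type} [NormedAddCommGroup E] [NormedSpace ℝ E]
    [CompleteSpace E] [NormedAddCommGroup F] [NormedSpace ℝ F]
    {f : E → F} {a : E} (hf : ContDiff ℝ ∞ f) (f' : E ≃L[ℝ] F)
    (hf' : HasFDerivAt f (f' : E →L[ℝ] F) a) {W : Set E} (hW : W ∈ 𝓝 a) :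
    ∃ e : OpenPartialHomeomorph E F, a ∈ e.source ∧ e.source ⊆ W ∧ (e : E → F) = f ∧
      ContDiffOn ℝ ∞ e.symm e.target := by
  have hn : (∞ : WithTop ℕ∞) ≠ 0 := by simp
  let e₀ := (hf.contDiffAt (x := a)).toOpenPartialHomeomorph f hf' hn
  have hcont : Continuous (fderiv ℝ f) := hf.continuous_fderiv (by simp)
  have hopen : IsOpen {x | fderiv ℝ f x ∈ Set.range ((↑) : (E ≃L[ℝ] F) → E →L[ℝ] F)} :=
    (ContinuousLinearEquiv.isOpen (𝕜 := ℝ) (E := E) (F := F)).preimage hcont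
  have hint : IsOpen (interior W) := isOpen_interior
  let e := e₀.restrOpen _ (hopen.inter hint)
  have hsrc : e.source = e₀.source ∩
    ({x | fderiv ℝ f x ∈ Set.range ((↑) : (E ≃L[ℝ] F) → E →L[ℝ] F)} ∩ interior W) := by
    simp [e]
  refine ⟨e, ?_, ?_, rfl, ?_⟩
  · rw [hsrc]
    exact ⟨hf.contDiffAt.mem_toOpenPartialHomeomorph_source hf' hn, ⟨f', hf'.fderiv.symm⟩,
      mem_interior_iff_mem_nhds.2 hW⟩
  · rw [hsrc]; exact fun x hx => interior_subset hx.2.2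
  · intro y hy
    have h1 : e.symm y ∈ e.source := e.map_target hy
    rw [hsrc] at h1
    obtain ⟨g', hg'⟩ := h1.2.1
    have h2 : HasFDerivAt e (g' : E →L[ℝ] F) (e.symm y) := by
      rw [hg']
      exact (hf.differentiable (by simp) _).hasFDerivAt
    exact (e.contDiffAt_symm hy h2 hf.contDiffAt).contDiffWithinAt

section nem
variable {K : Type} [TopologicalSpace K] [CompactSpace K]

def nem {E F : Type} [NormedAddCommGroup E] [NormedAddCommGroup F]
    (X : E → F) (hX : Continuous X) (u : C(K, E)) : C(K, F) := ⟨fun t => X (u t), by fun_prop⟩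

noncomputable def nemL (K : Type) [TopologicalSpace K] [CompactSpace K] (E F : Type)
    [NormedAddCommGroup E] [NormedSpace ℝ E]
    [NormedAddCommGroup F] [NormedSpace ℝ F] :
    C(K, E →L[ℝ] F) →L[ℝ] C(K, E) →L[ℝ] C(K, F) :=
  LinearMap.mkContinuous₂
    (LinearMap.mk₂ ℝ (fun (A : C(K, E →L[ℝ] F)) (h : C(K, E)) => (⟨fun t => A t (h t), by fun_prop⟩ : C(K, F)))
      (by intros; ext; simp) (by intros; ext; simp) (by intros; ext; simp) (by intros; ext; simp))
    1 (by
      intro A h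
      rw [ContinuousMap.norm_le _ (by positivity)]
      intro t
      simp only [LinearMap.mk₂_apply, ContinuousMap.coe_mk, one_mul]
      exact ((A t).le_opNorm _).trans (mul_le_mul (A.norm_coe_le_norm t) (h.norm_coe_le_norm t)
        (norm_nonneg _) (by positivity)))

theorem nem_hasFDerivAt {E F : Type} [NormedAddCommGroup E] [NormedSpace ℝ E]
    [NormedAddCommGroup F] [NormedSpace ℝ F] (X : E → F) (hX : ContDiff ℝ 1 X) (u : C(K, E)) :
    HasFDerivAt (nem (K := K) X hX.continuous)
      (nemL K E F (nem (fderiv ℝ X) (hX.continuous_fderiv (by simp)) u)) u := by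
  rw [hasFDerivAt_iff_isLittleO_nhds_zero, Asymptotics.isLittleO_iff]
  intro ε hε
  have hc : IsCompact (Set.range u) := isCompact_range u.continuous
  have hu := hc.uniformContinuousAt_of_continuousAt (fderiv ℝ X)
    (fun a _ => (hX.continuous_fderiv (by simp)).continuousAt) (Metric.dist_mem_uniformity hε)
  obtain ⟨δ, hδ, H⟩ := Metric.mem_uniformity_dist.1 hu
  filter_upwards [Metric.ball_mem_nhds (0 : C(K, E)) hδ] with h hh
  rw [ContinuousMap.norm_le _ (by positivity)]
  intro t
  have hht : ‖h t‖ < δ := (h.norm_coe_le_norm t).trans_lt (by simpa using hh)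
  have key := (convex_ball (u t) δ).norm_image_sub_le_of_norm_hasFDerivWithin_le'
    (f := X) (f' := fderiv ℝ X) (φ := fderiv ℝ X (u t)) (C := ε) (x := u t) (y := u t + h t)
    (fun x _ => (hX.differentiable (by simp) x).hasFDerivAt.hasFDerivWithinAt)
    (fun x hx => by
      have := H (a := u t) (b := x) (by rw [dist_comm]; exact hx) ⟨t, rfl⟩
      rw [← dist_eq_norm, dist_comm]
      exact le_of_lt this)
    (Metric.mem_ball_self hδ) (by simpa using hht)
  have h2 : ε * ‖h t‖ ≤ ε * ‖h‖ := by gcongr; exact h.norm_coe_le_norm t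
  simp only [add_sub_cancel_left] at key
  exact key.trans h2

theorem nem_contDiff_nat (n : ℕ) : ∀ {E F : Type} [NormedAddCommGroup E] [NormedSpace ℝ E]
    [NormedAddCommGroup F] [NormedSpace ℝ F] (X : E → F) (hX : ContDiff ℝ n X),
    ContDiff ℝ n (nem (K := K) X hX.continuous) := by
  induction n with
  | zero =>
    intro E F _ _ _ _ X hX
    simp only [CharP.cast_eq_zero, contDiff_zero]
    exact ContinuousMap.continuous_postcomp (⟨X, hX.continuous⟩ : C(E, F))
  | succ n ih =>
    intro E F _ _ _ _ X hX
    have hX1 : ContDiff ℝ 1 X := hX.of_le (by norm_cast; omega)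
    have hd : ContDiff ℝ n (fderiv ℝ X) := hX.fderiv_right (by norm_cast)
    push_cast
    rw [contDiff_succ_iff_fderiv]
    refine ⟨fun u => (nem_hasFDerivAt X hX1 u).differentiableAt, by simp, ?_⟩
    have : fderiv ℝ (nem (K := K) X hX.continuous) =
        fun u => nemL K E F (nem (fderiv ℝ X) hd.continuous u) := by
      ext1 u
      exact (nem_hasFDerivAt X hX1 u).fderiv
    rw [this]
    exact (nemL K E F).contDiff.comp (ih _ hd)

theorem nem_contDiff {E F : Type} [NormedAddCommGroup E] [NormedSpace ℝ E]
    [NormedAddCommGroup F] [NormedSpace ℝ F] (X : E → F) (hX : ContDiff ℝ ∞ X) :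
    ContDiff ℝ ∞ (nem (K := K) X hX.continuous) := by
  rw [contDiff_infty]
  intro n
  exact nem_contDiff_nat n X (hX.of_le (by exact_mod_cast le_top))

end nem

abbrev KI := Set.Icc (-1 : ℝ) 1

section flow
set_option linter.unusedSectionVars false
variable {E : Type} [NormedAddCommGroup E] [NormedSpace ℝ E]

/-- extension of a continuous map on `[-1,1]` to the line -/
noncomputable def extK (v : C(KI, E)) : ℝ → E := fun τ => v (Set.projIcc (-1) 1 (by norm_num) τ)

theorem extK_continuous (v : C(KI, E)) : Continuous (extK v) :=
  v.continuous.comp continuous_projIcc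

theorem extK_of_mem (v : C(KI, E)) (t : KI) : extK v t = v t := by
  simp [extK, Set.projIcc_val]

theorem extK_norm_le (v : C(KI, E)) (τ : ℝ) : ‖extK v τ‖ ≤ ‖v‖ := v.norm_coe_le_norm _

/-- integration from `0` -/
noncomputable def intK [CompleteSpace E] : C(KI, E) →L[ℝ] C(KI, E) :=
  LinearMap.mkContinuous
    { toFun := fun v => ⟨fun t => ∫ τ in (0:ℝ)..t, extK v τ, by
        have : Continuous fun t : ℝ => ∫ τ in (0:ℝ)..t, extK v τ :=
          intervalIntegral.continuous_primitive
            (fun a b => (extK_continuous v).intervalIntegrable a b) 0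
        exact this.comp continuous_subtype_val⟩
      map_add' := fun v w => by
        ext t
        simp only [ContinuousMap.coe_mk, ContinuousMap.add_apply]
        rw [← intervalIntegral.integral_add ((extK_continuous v).intervalIntegrable _ _)
          ((extK_continuous w).intervalIntegrable _ _)]
        rfl
      map_smul' := fun c v => by
        ext t
        simp only [ContinuousMap.coe_mk, ContinuousMap.smul_apply, RingHom.id_apply]
        rw [← intervalIntegral.integral_smul]
        rfl }
    1 (by
      intro v
      rw [ContinuousMap.norm_le _ (by positivity)]
      intro t
      have h := intervalIntegral.norm_integral_le_of_norm_le_const (a := 0) (b := (t : ℝ))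
        (f := extK v) (C := ‖v‖) (fun x _ => extK_norm_le v x)
      have ht : |(t : ℝ) - 0| ≤ 1 := by rw [sub_zero, abs_le]; exact t.2
      refine h.trans ?_
      rw [one_mul]
      exact mul_le_of_le_one_right (norm_nonneg _) ht)

theorem intK_apply [CompleteSpace E] (v : C(KI, E)) (t : KI) :
    intK v t = ∫ τ in (0:ℝ)..t, extK v τ := rfl

/-- reparametrisation by a factor `c ∈ [-1,1]` -/
def mulK (c : KI) : C(KI, KI) := ⟨fun t => ⟨c * t, by
  have h1 := abs_le.2 c.2
  have h2 := abs_le.2 t.2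
  apply abs_le.1
  rw [abs_mul]
  exact mul_le_one₀ h1 (abs_nonneg _) h2⟩, by fun_prop⟩

theorem intK_comp [CompleteSpace E] (v : C(KI, E)) (c : KI) :
    (intK v).comp (mulK c) = (c : ℝ) • intK (v.comp (mulK c)) := by
  ext t
  simp only [ContinuousMap.comp_apply, ContinuousMap.smul_apply, intK_apply]
  have h : ((mulK c t : KI) : ℝ) = (c : ℝ) * t := rfl
  rw [h]
  have h2 := intervalIntegral.smul_integral_comp_mul_left (f := extK v) (a := 0) (b := (t : ℝ)) (c : ℝ)
  rw [mul_zero] at h2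
  rw [← h2]
  congr 1
  apply intervalIntegral.integral_congr
  intro τ hτ
  have hτ' : τ ∈ KI := by
    have ht := t.2
    rcases Set.mem_uIcc.1 hτ with h | h
    · exact ⟨by linarith [h.1], h.2.trans ht.2⟩
    · exact ⟨ht.1.trans h.1, by linarith [h.2]⟩
  have e1 : extK (v.comp (mulK c)) τ = v (mulK c ⟨τ, hτ'⟩) := extK_of_mem (v.comp (mulK c)) ⟨τ, hτ'⟩
  rw [e1]
  exact extK_of_mem v (mulK c ⟨τ, hτ'⟩)

theorem exists_flow [FiniteDimensional ℝ E] (X : E → E) (hX : ContDiff ℝ ∞ X) (x₀ : E) :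
    ∃ Φ : E × ℝ → E, ContDiff ℝ ∞ Φ ∧ (∀ᶠ x in 𝓝 x₀, Φ (x, 0) = x) ∧
      ∀ᶠ p in 𝓝 (x₀, (0:ℝ)), HasDerivAt (fun s => Φ (p.1, s)) (X (Φ p)) p.2 := by
  have : CompleteSpace E := FiniteDimensional.complete ℝ E
  let cst : E →L[ℝ] C(KI, E) := ContinuousLinearMap.const ℝ KI
  let N : C(KI, E) → C(KI, E) := nem X hX.continuous
  have hN : ContDiff ℝ ∞ N := nem_contDiff X hX
  let G : (E × ℝ × C(KI, E)) → (E × ℝ × C(KI, E)) := fun p => (p.1, p.2.1, p.2.2 - cst p.1 - p.2.1 • intK (N p.2.2))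
  have hG : ContDiff ℝ ∞ G := by
    have h1 : ContDiff ℝ ∞ fun p : E × ℝ × C(KI, E) => intK (N p.2.2) :=
      intK.contDiff.comp (hN.comp (contDiff_snd.comp contDiff_snd))
    have h2 : ContDiff ℝ ∞ fun p : E × ℝ × C(KI, E) => cst p.1 := cst.contDiff.comp contDiff_fst
    exact contDiff_fst.prodMk ((contDiff_fst.comp contDiff_snd).prodMk
      (((contDiff_snd.comp contDiff_snd).sub h2).sub ((contDiff_fst.comp contDiff_snd).smul h1)))
  let p₀ : E × ℝ × C(KI, E) := (x₀, 0, cst x₀)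
  let J₀ : C(KI, E) := intK (N (cst x₀))
  let A : (E × ℝ × C(KI, E)) →L[ℝ] (E × ℝ × C(KI, E)) := (ContinuousLinearMap.fst ℝ _ _).prod
    (((ContinuousLinearMap.fst ℝ _ _).comp (ContinuousLinearMap.snd ℝ _ _)).prod
      ((ContinuousLinearMap.snd ℝ _ _).comp (ContinuousLinearMap.snd ℝ _ _) -
        cst.comp (ContinuousLinearMap.fst ℝ _ _) -
        ((ContinuousLinearMap.fst ℝ _ _).comp (ContinuousLinearMap.snd ℝ E (ℝ × C(KI, E)))).smulRight J₀))
  let A' : (E × ℝ × C(KI, E)) →L[ℝ] (E × ℝ × C(KI, E)) := (ContinuousLinearMap.fst ℝ _ _).prod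
    (((ContinuousLinearMap.fst ℝ _ _).comp (ContinuousLinearMap.snd ℝ _ _)).prod
      ((ContinuousLinearMap.snd ℝ _ _).comp (ContinuousLinearMap.snd ℝ _ _) +
        cst.comp (ContinuousLinearMap.fst ℝ _ _) +
        ((ContinuousLinearMap.fst ℝ _ _).comp (ContinuousLinearMap.snd ℝ E (ℝ × C(KI, E)))).smulRight J₀))
  let Ae : (E × ℝ × C(KI, E)) ≃L[ℝ] (E × ℝ × C(KI, E)) := ContinuousLinearEquiv.equivOfInverse A A'
    (fun p => by
      refine Prod.ext rfl (Prod.ext rfl ?_)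
      change (p.2.2 - cst p.1 - p.2.1 • J₀) + cst p.1 + p.2.1 • J₀ = p.2.2
      abel)
    (fun p => by
      refine Prod.ext rfl (Prod.ext rfl ?_)
      change (p.2.2 + cst p.1 + p.2.1 • J₀) - cst p.1 - p.2.1 • J₀ = p.2.2
      abel)
  have hGA : HasFDerivAt G (Ae : (E × ℝ × C(KI, E)) →L[ℝ] (E × ℝ × C(KI, E))) p₀ := by
    have hf1 : HasFDerivAt (fun p : E × ℝ × C(KI, E) => p.1) (ContinuousLinearMap.fst ℝ _ _) p₀ := hasFDerivAt_fst
    have hf2 : HasFDerivAt (fun p : E × ℝ × C(KI, E) => p.2.1)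
      ((ContinuousLinearMap.fst ℝ _ _).comp (ContinuousLinearMap.snd ℝ _ _)) p₀ :=
      ((ContinuousLinearMap.fst ℝ _ _).comp (ContinuousLinearMap.snd ℝ E (ℝ × C(KI, E)))).hasFDerivAt
    have hf3 : HasFDerivAt (fun p : E × ℝ × C(KI, E) => p.2.2)
      ((ContinuousLinearMap.snd ℝ _ _).comp (ContinuousLinearMap.snd ℝ _ _)) p₀ :=
      ((ContinuousLinearMap.snd ℝ _ _).comp (ContinuousLinearMap.snd ℝ E (ℝ × C(KI, E)))).hasFDerivAt
    have h1 : ContDiff ℝ ∞ fun p : E × ℝ × C(KI, E) => intK (N p.2.2) :=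
      intK.contDiff.comp (hN.comp (contDiff_snd.comp contDiff_snd))
    have h1' := (h1.differentiable (by simp) p₀).hasFDerivAt
    have hs := hf2.smul h1'
    have htot := hf1.prodMk (hf2.prodMk ((hf3.sub (cst.hasFDerivAt.comp p₀ hf1)).sub hs))
    refine htot.congr_fderiv ?_
    refine ContinuousLinearMap.ext fun p => Prod.ext rfl (Prod.ext rfl ?_)
    change p.2.2 - cst p.1 - ((0:ℝ) • _ + p.2.1 • J₀) = p.2.2 - cst p.1 - p.2.1 • J₀
    rw [zero_smul, zero_add]
  obtain ⟨e, hp₀, -, heG, hes⟩ := smooth_inverse hG Ae hGA univ_mem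
  have hGp₀ : G p₀ = (x₀, 0, 0) := by simp [G, p₀]
  obtain ⟨r, hr, hrs⟩ := Metric.isOpen_iff.1 e.open_source p₀ hp₀
  have htgt : (x₀, (0:ℝ), (0 : C(KI, E))) ∈ e.target := by
    rw [← hGp₀, ← heG]; exact e.map_source hp₀
  have hsymm0 : e.symm (x₀, (0:ℝ), (0 : C(KI, E))) = p₀ := by
    rw [← hGp₀, ← heG]; exact e.left_inv hp₀
  let ι : E × ℝ → E × ℝ × C(KI, E) := fun q => (q.1, q.2, 0)
  have hι : ContDiff ℝ ∞ ι := contDiff_fst.prodMk (contDiff_snd.prodMk contDiff_const)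
  have hev : ∀ᶠ q in 𝓝 (x₀, (0:ℝ)), ι q ∈ e.target ∧ e.symm (ι q) ∈ Metric.ball p₀ r := by
    have c1 : ContinuousAt ι (x₀, 0) := hι.continuous.continuousAt
    have c2 : ContinuousAt (fun q => e.symm (ι q)) (x₀, 0) :=
      ContinuousAt.comp (f := ι) (g := e.symm) (e.continuousAt_symm htgt) c1
    refine (c1.eventually (e.open_target.mem_nhds htgt)).and (c2.eventually ?_)
    apply Metric.isOpen_ball.mem_nhds
    change e.symm (x₀, 0, 0) ∈ _
    rw [hsymm0]; exact Metric.mem_ball_self hr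
  obtain ⟨δ, hδ, hball⟩ := Metric.eventually_nhds_iff_ball.1 hev
  let one : KI := ⟨1, by norm_num⟩
  let Φ₀ : E × ℝ → E := fun q => (e.symm (ι q)).2.2 one
  have hΦ₀ : ContDiffOn ℝ ∞ Φ₀ (Metric.ball (x₀, 0) δ) := by
    have h1 : ContDiffOn ℝ ∞ (fun q => e.symm (ι q)) (Metric.ball (x₀, 0) δ) :=
      hes.comp hι.contDiffOn (fun q hq => (hball q hq).1)
    have h2 : ContDiff ℝ ∞ (fun p : E × ℝ × C(KI, E) => p.2.2 one) := by
      have h0 : ContDiff ℝ ∞ (fun v : C(KI, E) => v one) :=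
        ContinuousLinearMap.contDiff (ContinuousMap.evalCLM ℝ one : C(KI, E) →L[ℝ] E)
      exact h0.comp (contDiff_snd.comp contDiff_snd)
    exact h2.comp_contDiffOn h1
  -- properties of the solution
  have hsol : ∀ q ∈ Metric.ball (x₀, (0:ℝ)) δ, (e.symm (ι q)).1 = q.1 ∧ (e.symm (ι q)).2.1 = q.2 ∧
      (e.symm (ι q)).2.2 = cst q.1 + q.2 • intK (N (e.symm (ι q)).2.2) := by
    intro q hq
    have h := e.right_inv (hball q hq).1
    rw [heG] at h
    have h1 : (e.symm (ι q)).1 = q.1 := congrArg Prod.fst h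
    have h2 : (e.symm (ι q)).2.1 = q.2 := congrArg (fun p : E × ℝ × C(KI, E) => p.2.1) h
    have h3 : (e.symm (ι q)).2.2 - cst (e.symm (ι q)).1 -
      (e.symm (ι q)).2.1 • intK (N (e.symm (ι q)).2.2) = 0 := congrArg (fun p : E × ℝ × C(KI, E) => p.2.2) h
    refine ⟨h1, h2, ?_⟩
    rw [h1, h2, sub_sub, sub_eq_zero] at h3
    exact h3
  set s₀ : ℝ := min (δ / 2) (r / 2) with hs₀
  have hs₀pos : 0 < s₀ := by positivity
  have hs₀δ : s₀ < δ := (min_le_left _ _).trans_lt (by linarith)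
  have hs₀r : s₀ < r := (min_le_right _ _).trans_lt (by linarith)
  have hmem : ∀ x ∈ Metric.ball x₀ δ, (x, s₀) ∈ Metric.ball (x₀, (0:ℝ)) δ := by
    intro x hx
    rw [← ball_prod_same]
    exact ⟨hx, by simpa [abs_of_pos hs₀pos] using hs₀δ⟩
  let U : E → C(KI, E) := fun x => (e.symm (ι (x, s₀))).2.2
  have hresc : ∀ x ∈ Metric.ball x₀ δ, ∀ c : KI, Φ₀ (x, s₀ * c) = U x c := by
    intro x hx c
    obtain ⟨h1, h2, h3⟩ := hsol _ (hmem x hx)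
    have hb := (hball _ (hmem x hx)).2
    let v := (U x).comp (mulK c)
    have hv : v = cst x + (s₀ * c) • intK (N v) := by
      have h4 : U x = cst x + s₀ • intK (N (U x)) := h3
      have h5 : v = (cst x + s₀ • intK (N (U x))).comp (mulK c) := by rw [← h4]
      have h6 : (intK (N (U x))).comp (mulK c) = (c : ℝ) • intK (N v) := intK_comp (N (U x)) c
      calc v = (cst x + s₀ • intK (N (U x))).comp (mulK c) := h5
        _ = cst x + s₀ • (intK (N (U x))).comp (mulK c) := rfl
        _ = _ := by rw [h6, mul_smul]
    have hvmem : (x, s₀ * (c : ℝ), v) ∈ e.source := by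
      apply hrs
      have hbx : dist x x₀ < r := by
        have : dist (e.symm (ι (x, s₀))).1 x₀ ≤ dist (e.symm (ι (x, s₀))) p₀ := le_max_left _ _
        rw [h1] at this
        exact this.trans_lt hb
      have hbu : dist (U x) (cst x₀) < r := by
        have : dist (e.symm (ι (x, s₀))).2.2 (cst x₀) ≤ dist (e.symm (ι (x, s₀))) p₀ :=
          (le_max_right _ _).trans (le_max_right _ _)
        exact this.trans_lt hb
      have hbs : dist (s₀ * (c : ℝ)) 0 < r := by
        rw [dist_zero_right, Real.norm_eq_abs, abs_mul, abs_of_pos hs₀pos]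
        exact (mul_le_of_le_one_right hs₀pos.le (abs_le.2 c.2)).trans_lt hs₀r
      have hbv : dist v (cst x₀) < r := by
        refine lt_of_le_of_lt ?_ hbu
        rw [ContinuousMap.dist_le dist_nonneg]
        intro t
        exact ContinuousMap.dist_apply_le_dist (f := U x) (g := cst x₀) (mulK c t)
      exact max_lt hbx (max_lt hbs hbv)
    have hGv : e (x, s₀ * (c : ℝ), v) = ι (x, s₀ * c) := by
      rw [heG]
      refine Prod.ext rfl (Prod.ext rfl ?_)
      change v - cst x - (s₀ * (c:ℝ)) • intK (N v) = 0
      rw [sub_sub, sub_eq_zero]; exact hv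
    have : e.symm (ι (x, s₀ * c)) = (x, s₀ * (c : ℝ), v) := by
      rw [← hGv]; exact e.left_inv hvmem
    change (e.symm (ι (x, s₀ * c))).2.2 one = _
    rw [this]
    change U x (mulK c one) = U x c
    congr 1
    ext
    simp [mulK, one]
  have hU : ∀ x ∈ Metric.ball x₀ δ, ∀ c : KI, U x c = x + s₀ • ∫ τ in (0:ℝ)..c, extK (N (U x)) τ := by
    intro x hx c
    have h3 := (hsol _ (hmem x hx)).2.2
    exact congrArg (fun w : C(KI, E) => w c) h3
  have hzero : ∀ x ∈ Metric.ball x₀ δ, Φ₀ (x, 0) = x := by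
    intro x hx
    have h := hresc x hx ⟨0, by norm_num⟩
    rw [hU x hx] at h
    simpa using h
  have hder : ∀ x ∈ Metric.ball x₀ δ, ∀ s ∈ Set.Ioo (-s₀) s₀,
      HasDerivAt (fun s => Φ₀ (x, s)) (X (Φ₀ (x, s))) s := by
    intro x hx s hs
    have hin : ∀ s ∈ Set.Ioo (-s₀) s₀, s / s₀ ∈ KI := by
      intro s hs
      constructor
      · rw [le_div_iff₀ hs₀pos]; linarith [hs.1]
      · rw [div_le_iff₀ hs₀pos]; linarith [hs.2]
    have hval : ∀ (s : ℝ) (hs : s ∈ Set.Ioo (-s₀) s₀), Φ₀ (x, s) = U x ⟨s / s₀, hin s hs⟩ := by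
      intro s hs
      rw [← hresc x hx]
      congr 2
      field_simp
    have heq : (fun s => Φ₀ (x, s)) =ᶠ[𝓝 s]
        fun s => x + s₀ • ∫ τ in (0:ℝ)..(s / s₀), extK (N (U x)) τ := by
      filter_upwards [isOpen_Ioo.mem_nhds hs] with s' hs'
      rw [hval s' hs', hU x hx]
    have hd1 : HasDerivAt (fun t => ∫ τ in (0:ℝ)..t, extK (N (U x)) τ)
        (extK (N (U x)) (s / s₀)) (s / s₀) :=
      intervalIntegral.integral_hasDerivAt_right
        ((extK_continuous _).intervalIntegrable _ _)
        (extK_continuous _).stronglyMeasurable.stronglyMeasurableAtFilter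
        (extK_continuous _).continuousAt
    have hd2 : HasDerivAt (fun s : ℝ => s / s₀) (1 / s₀) s := (hasDerivAt_id s).div_const s₀
    have hd3 := ((hd1.scomp s hd2).const_smul s₀).const_add x
    refine (HasDerivAt.congr_of_eventuallyEq ?_ heq)
    have hd4 : HasDerivAt (fun s => x + s₀ • ∫ τ in (0:ℝ)..(s / s₀), extK (N (U x)) τ)
      (s₀ • ((1 / s₀) • extK (N (U x)) (s / s₀))) s := hd3
    refine hd4.congr_deriv ?_
    rw [smul_smul, mul_one_div_cancel hs₀pos.ne', one_smul, hval s hs]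
    exact (extK_of_mem (N (U x)) ⟨s / s₀, hin s hs⟩)
  obtain ⟨Φ, hΦ, hΦe⟩ := exists_global_smooth (Metric.ball_mem_nhds (x₀, (0:ℝ)) hδ) hΦ₀
  refine ⟨Φ, hΦ, ?_, ?_⟩
  · have c : ContinuousAt (fun x : E => (x, (0:ℝ))) x₀ := by fun_prop
    filter_upwards [c.eventually hΦe, Metric.ball_mem_nhds x₀ hδ] with x h1 h2
    rw [h1, hzero x h2]
  · have hnh : Metric.ball x₀ δ ×ˢ Set.Ioo (-s₀) s₀ ∈ 𝓝 (x₀, (0:ℝ)) :=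
      prod_mem_nhds (Metric.ball_mem_nhds x₀ hδ) (Ioo_mem_nhds (by linarith) hs₀pos)
    filter_upwards [hΦe.eventually_nhds, hnh] with p h1 h2
    have h3 := hder p.1 h2.1 p.2 h2.2
    have c : ContinuousAt (fun s : ℝ => (p.1, s)) p.2 := by fun_prop
    have h4 : (fun s => Φ (p.1, s)) =ᶠ[𝓝 p.2] fun s => Φ₀ (p.1, s) := c.eventually h1
    rw [h1.self_of_nhds]
    exact h3.congr_of_eventuallyEq h4

end flow

section forms
set_option linter.unusedSectionVars false
set_option linter.unusedVariables false
variable {E H : Type} [NormedAddCommGroup E] [NormedSpace ℝ E] [FiniteDimensional ℝ E]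
  [NormedAddCommGroup H] [NormedSpace ℝ H] [FiniteDimensional ℝ H]

theorem exists_adapted_equiv (hdim : Module.finrank ℝ E = Module.finrank ℝ H + 1)
    (v : E) (hv : v ≠ 0) : ∃ A : (H × ℝ) ≃L[ℝ] E, A (0, 1) = v := by
  obtain ⟨l, hl⟩ := SeparatingDual.exists_eq_one (R := ℝ) hv
  have hsurj : Function.Surjective (l : E →ₗ[ℝ] ℝ) := fun t => ⟨t • v, by simp [hl]⟩
  have hk : Module.finrank ℝ H = Module.finrank ℝ (LinearMap.ker (l : E →ₗ[ℝ] ℝ)) := by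
    have h := LinearMap.finrank_range_add_finrank_ker (l : E →ₗ[ℝ] ℝ)
    rw [LinearMap.range_eq_top.2 hsurj, finrank_top, Module.finrank_self] at h
    omega
  let κ := LinearEquiv.ofFinrankEq H _ hk
  let A₀ : (H × ℝ) →ₗ[ℝ] E :=
    LinearMap.coprod ((Submodule.subtype _).comp κ.toLinearMap) (LinearMap.toSpanSingleton ℝ E v)
  have hA : ∀ h t, A₀ (h, t) = (κ h : E) + t • v := fun h t => by simp [A₀]
  have hinj : Function.Injective A₀ := by
    rw [injective_iff_map_eq_zero]
    rintro ⟨h, t⟩ h0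
    rw [hA] at h0
    have h1 : l ((κ h : E) + t • v) = 0 := by rw [h0, map_zero]
    have h2 : l (κ h : E) = 0 := (κ h).2
    rw [map_add, h2, map_smul, hl] at h1
    have ht : t = 0 := by simpa using h1
    rw [ht, zero_smul, add_zero] at h0
    have : κ h = 0 := Subtype.ext h0
    rw [ht, (LinearEquiv.map_eq_zero_iff κ).1 this]; rfl
  have hd : Module.finrank ℝ (H × ℝ) = Module.finrank ℝ E := by
    rw [Module.finrank_prod, Module.finrank_self, hdim]
  refine ⟨(LinearMap.linearEquivOfInjective A₀ hinj hd).toContinuousLinearEquiv, ?_⟩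
  change A₀ (0, 1) = v
  rw [hA]; simp

theorem flow_box (hdim : Module.finrank ℝ E = Module.finrank ℝ H + 1)
    (X : E → E) (hX : ContDiff ℝ ∞ X) (x₀ : E) (h0 : X x₀ ≠ 0) :
    ∃ (φ : H × ℝ → E) (ψ : E → H × ℝ), ContDiff ℝ ∞ φ ∧ ContDiff ℝ ∞ ψ ∧ φ 0 = x₀ ∧ ψ x₀ = 0 ∧
      (∀ᶠ p in 𝓝 0, ψ (φ p) = p) ∧ (∀ᶠ x in 𝓝 x₀, φ (ψ x) = x) ∧
      ∀ᶠ p in 𝓝 0, fderiv ℝ φ p (0, 1) = X (φ p) := by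
  have : CompleteSpace E := FiniteDimensional.complete ℝ E
  have : CompleteSpace H := FiniteDimensional.complete ℝ H
  obtain ⟨A, hA⟩ := exists_adapted_equiv (H := H) hdim (X x₀) h0
  obtain ⟨Φ, hΦ, hΦ0, hΦd⟩ := exists_flow X hX x₀
  let κ : H →L[ℝ] E := (A : H × ℝ →L[ℝ] E).comp (ContinuousLinearMap.inl ℝ H ℝ)
  let j : H × ℝ → E × ℝ := fun p => (x₀ + κ p.1, p.2)
  have hj : ContDiff ℝ ∞ j :=
    (contDiff_const.add (κ.contDiff.comp contDiff_fst)).prodMk contDiff_snd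
  have hj0 : j 0 = (x₀, 0) := by simp [j]
  let φ : H × ℝ → E := fun p => Φ (j p)
  have hφ : ContDiff ℝ ∞ φ := hΦ.comp hj
  have hφ0 : φ 0 = x₀ := by change Φ (j 0) = x₀; rw [hj0]; exact hΦ0.self_of_nhds
  have hcol : ∀ᶠ p in 𝓝 (0 : H × ℝ), fderiv ℝ φ p (0, 1) = X (φ p) := by
    have hc : Tendsto j (𝓝 0) (𝓝 (x₀, 0)) := by rw [← hj0]; exact hj.continuous.continuousAt
    filter_upwards [hc.eventually hΦd] with p hp
    have h1 : HasFDerivAt φ (fderiv ℝ φ p) (p.1, p.2) := (hφ.differentiable (by simp) p).hasFDerivAt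
    have h2 : HasDerivAt (fun s : ℝ => (p.1, s)) ((0 : H), (1 : ℝ)) p.2 :=
      (hasDerivAt_const _ _).prodMk (hasDerivAt_id _)
    have h3 := h1.comp_hasDerivAt p.2 h2
    exact h3.unique hp
  have hder : HasFDerivAt φ (A : H × ℝ →L[ℝ] E) 0 := by
    have h1 : HasFDerivAt φ (fderiv ℝ φ 0) 0 := (hφ.differentiable (by simp) 0).hasFDerivAt
    refine h1.congr_fderiv ?_
    apply ContinuousLinearMap.prod_ext
    · have h2 : HasFDerivAt (fun h : H => φ (h, 0))
          ((fderiv ℝ φ 0).comp (ContinuousLinearMap.inl ℝ H ℝ)) 0 :=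
        HasFDerivAt.comp (f := fun h : H => (h, (0:ℝ))) (g := φ) 0 h1
          (ContinuousLinearMap.inl ℝ H ℝ).hasFDerivAt
      have h3 : (fun h : H => φ (h, 0)) =ᶠ[𝓝 0] fun h => x₀ + κ h := by
        have hc : Tendsto (fun h : H => x₀ + κ h) (𝓝 0) (𝓝 x₀) := by
          have : Continuous fun h : H => x₀ + κ h := by fun_prop
          simpa using this.tendsto 0
        exact hc.eventually hΦ0
      have h4 : HasFDerivAt (fun h : H => x₀ + κ h) κ 0 := κ.hasFDerivAt.const_add x₀
      exact h2.unique (h4.congr_of_eventuallyEq h3)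
    · apply ContinuousLinearMap.ext_ring
      have := hcol.self_of_nhds
      rw [hφ0] at this
      simpa [hA] using this
  obtain ⟨e, he0, -, heq, hes⟩ := smooth_inverse hφ A hder univ_mem
  have htm : x₀ ∈ e.target := by rw [← hφ0, ← heq]; exact e.map_source he0
  obtain ⟨ψ, hψ, hψe⟩ := exists_global_smooth (e.open_target.mem_nhds htm) hes
  refine ⟨φ, ψ, hφ, hψ, hφ0, ?_, ?_, ?_, hcol⟩
  · rw [hψe.self_of_nhds]
    have := e.left_inv he0
    rwa [heq, hφ0] at this
  · have hc : Tendsto φ (𝓝 0) (𝓝 x₀) := by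
      have := hφ.continuous.tendsto 0
      rwa [hφ0] at this
    filter_upwards [hc.eventually hψe, e.open_source.mem_nhds he0] with p h1 h2
    rw [h1, ← heq]; exact e.left_inv h2
  · filter_upwards [hψe, e.open_target.mem_nhds htm] with x h1 h2
    rw [h1, ← heq]; exact e.right_inv h2

theorem exists_time (hd : 0 < Module.finrank ℝ E) (X : E → E) (hX : ContDiff ℝ ∞ X) (x₀ : E)
    (h0 : X x₀ ≠ 0) :
    ∃ q : E → ℝ, ContDiff ℝ ∞ q ∧ q x₀ = 0 ∧ ∀ᶠ x in 𝓝 x₀, fderiv ℝ q x (X x) = 1 := by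
  obtain ⟨n, hn⟩ : ∃ n, Module.finrank ℝ E = n + 1 := ⟨_, (Nat.succ_pred_eq_of_pos hd).symm⟩
  obtain ⟨φ, ψ, hφ, hψ, hφ0, hψ0, hl, hr, hcol⟩ := flow_box (H := Fin n → ℝ) (by simpa using hn) X hX x₀ h0
  refine ⟨fun x => (ψ x).2, contDiff_snd.comp hψ, by simp [hψ0], ?_⟩
  have hc : Tendsto ψ (𝓝 x₀) (𝓝 0) := by
    have := hψ.continuous.tendsto x₀
    rwa [hψ0] at this
  filter_upwards [hr, hc.eventually hcol, hc.eventually hl.eventually_nhds] with x h1 h2 h3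
  rw [h1] at h2
  have d1 : HasFDerivAt (fun x => (ψ x).2) ((ContinuousLinearMap.snd ℝ _ _).comp (fderiv ℝ ψ x)) x :=
    (hψ.differentiable (by simp) x).hasFDerivAt.snd
  rw [d1.fderiv, ← h2]
  have dφ : HasFDerivAt φ (fderiv ℝ φ (ψ x)) (ψ x) := (hφ.differentiable (by simp) _).hasFDerivAt
  have dψ : HasFDerivAt ψ (fderiv ℝ ψ x) (φ (ψ x)) := by
    rw [h1]; exact (hψ.differentiable (by simp) _).hasFDerivAt
  have d2 := dψ.comp (ψ x) dφ
  have d3 : HasFDerivAt (ψ ∘ φ) (ContinuousLinearMap.id ℝ _) (ψ x) :=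
    (hasFDerivAt_id _).congr_of_eventuallyEq h3
  have := congrArg (fun L : ((Fin n → ℝ) × ℝ) →L[ℝ] ((Fin n → ℝ) × ℝ) => L (0, 1)) (d2.unique d3)
  simp only [ContinuousLinearMap.comp_apply, ContinuousLinearMap.id_apply] at this
  rw [ContinuousLinearMap.comp_apply, this]; rfl

/-- closedness of a 2-form at a point -/
def ClosedAt (B : E → E →L[ℝ] E →L[ℝ] ℝ) (x : E) : Prop :=
  ∀ u v w, fderiv ℝ B x u v w + fderiv ℝ B x v w u + fderiv ℝ B x w u v = 0

def SkewAt (B : E → E →L[ℝ] E →L[ℝ] ℝ) (x : E) : Prop := ∀ u v, B x u v = - B x v u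

/-- pullback of a 2-form -/
noncomputable def pb (φ : H → E) (B : E → E →L[ℝ] E →L[ℝ] ℝ) (x : H) : H →L[ℝ] H →L[ℝ] ℝ :=
  ((ContinuousLinearMap.compL ℝ H E ℝ).flip (fderiv ℝ φ x)).comp ((B (φ x)).comp (fderiv ℝ φ x))

theorem pb_apply (φ : H → E) (B : E → E →L[ℝ] E →L[ℝ] ℝ) (x : H) (u v : H) :
    pb φ B x u v = B (φ x) (fderiv ℝ φ x u) (fderiv ℝ φ x v) := rfl

theorem pb_contDiff {φ : H → E} {B : E → E →L[ℝ] E →L[ℝ] ℝ} (hφ : ContDiff ℝ ∞ φ)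
    (hB : ContDiff ℝ ∞ B) : ContDiff ℝ ∞ (pb φ B) := by
  have h1 : ContDiff ℝ ∞ (fderiv ℝ φ) := hφ.fderiv_right (by simp)
  rw [contDiff_clm_apply_iff]
  intro u
  rw [contDiff_clm_apply_iff]
  intro v
  exact ((hB.comp hφ).clm_apply (h1.clm_apply contDiff_const)).clm_apply
    (h1.clm_apply contDiff_const)

theorem fderiv_apply₂ {B : E → E →L[ℝ] E →L[ℝ] ℝ} {x : E} (hB : DifferentiableAt ℝ B x) (u v w : E) :
    fderiv ℝ (fun y => B y v w) x u = fderiv ℝ B x u v w := by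
  have h := (hB.hasFDerivAt.clm_apply (hasFDerivAt_const v x)).clm_apply (hasFDerivAt_const w x)
  rw [h.fderiv]; simp

theorem pb_skew {φ : H → E} {B : E → E →L[ℝ] E →L[ℝ] ℝ} {x : H} (h : SkewAt B (φ x)) :
    SkewAt (pb φ B) x := fun u v => h _ _

theorem pb_closed {φ : H → E} {B : E → E →L[ℝ] E →L[ℝ] ℝ} (hφ : ContDiff ℝ ∞ φ)
    (hB : ContDiff ℝ ∞ B) {x : H} (h : SkewAt B (φ x)) (hc : ClosedAt B (φ x)) :
    ClosedAt (pb φ B) x := by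
  have dpb : DifferentiableAt ℝ (pb φ B) x := (pb_contDiff hφ hB).differentiable (by simp) x
  have dφ : HasFDerivAt φ (fderiv ℝ φ x) x := (hφ.differentiable (by simp) x).hasFDerivAt
  have dB : HasFDerivAt B (fderiv ℝ B (φ x)) (φ x) := (hB.differentiable (by simp) _).hasFDerivAt
  have dd : HasFDerivAt (fderiv ℝ φ) (fderiv ℝ (fderiv ℝ φ) x) x :=
    ((hφ.fderiv_right (m := ∞) (by simp)).differentiable (by simp) x).hasFDerivAt
  have hsymm : ∀ u v, fderiv ℝ (fderiv ℝ φ) x u v = fderiv ℝ (fderiv ℝ φ) x v u := fun u v =>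
    (hφ.contDiffAt.isSymmSndFDerivAt (by simp; exact WithTop.coe_le_coe.2 (le_top : (2 : ℕ∞) ≤ ⊤))) u v
  have key : ∀ u v w, fderiv ℝ (pb φ B) x u v w =
      fderiv ℝ B (φ x) (fderiv ℝ φ x u) (fderiv ℝ φ x v) (fderiv ℝ φ x w) +
      B (φ x) (fderiv ℝ (fderiv ℝ φ) x u v) (fderiv ℝ φ x w) +
      B (φ x) (fderiv ℝ φ x v) (fderiv ℝ (fderiv ℝ φ) x u w) := by
    intro u v w
    rw [← fderiv_apply₂ dpb]
    have d1 := HasFDerivAt.comp (f := φ) (g := B) x dB dφ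
    have d2 := dd.clm_apply (hasFDerivAt_const v x)
    have d3 := dd.clm_apply (hasFDerivAt_const w x)
    have d4 : HasFDerivAt (fun y => (B ∘ φ) y (fderiv ℝ φ y v)) _ x := d1.clm_apply d2
    have hd := d4.clm_apply d3
    have e : (fun y => pb φ B y v w) = fun y => ((B ∘ φ) y) (fderiv ℝ φ y v) (fderiv ℝ φ y w) := rfl
    rw [e, hd.fderiv]
    simp
    ring
  intro u v w
  rw [key, key, key, hsymm v u, hsymm w u, hsymm w v]
  have h1 := hc (fderiv ℝ φ x u) (fderiv ℝ φ x v) (fderiv ℝ φ x w)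
  have h2 := h (fderiv ℝ (fderiv ℝ φ) x u v) (fderiv ℝ φ x w)
  have h3 := h (fderiv ℝ (fderiv ℝ φ) x u w) (fderiv ℝ φ x v)
  have h4 := h (fderiv ℝ (fderiv ℝ φ) x v w) (fderiv ℝ φ x u)
  linarith

end forms

section reduction
set_option linter.unusedSectionVars false
set_option linter.unusedVariables false
variable {E H : Type} [NormedAddCommGroup E] [NormedSpace ℝ E] [FiniteDimensional ℝ E]
  [NormedAddCommGroup H] [NormedSpace ℝ H] [FiniteDimensional ℝ H]

theorem reduce (hdim : Module.finrank ℝ E = Module.finrank ℝ H + 1)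
    (X : E → E) (hX : ContDiff ℝ ∞ X) (x₀ : E) (h0 : X x₀ ≠ 0)
    (B : E → E →L[ℝ] E →L[ℝ] ℝ) (hB : ContDiff ℝ ∞ B) (hc : ∀ᶠ x in 𝓝 x₀, ClosedAt B x)
    (hs : ∀ᶠ x in 𝓝 x₀, SkewAt B x) (hBX : ∀ᶠ x in 𝓝 x₀, ∀ v, B x (X x) v = 0) :
    ∃ (ρ : E → H) (B' : H → H →L[ℝ] H →L[ℝ] ℝ), ContDiff ℝ ∞ ρ ∧ ρ x₀ = 0 ∧ ContDiff ℝ ∞ B' ∧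
      (∀ᶠ z in 𝓝 0, ClosedAt B' z) ∧ (∀ᶠ z in 𝓝 0, SkewAt B' z) ∧
      ∀ᶠ x in 𝓝 x₀, ∀ u v, B x u v = pb ρ B' x u v := by
  obtain ⟨φ, ψ, hφ, hψ, hφ0, hψ0, hl, hr, hcol⟩ := flow_box (H := H) hdim X hX x₀ h0
  have cφ : Tendsto φ (𝓝 0) (𝓝 x₀) := by
    have := hφ.continuous.tendsto 0
    rwa [hφ0] at this
  have cψ : Tendsto ψ (𝓝 x₀) (𝓝 0) := by
    have := hψ.continuous.tendsto x₀
    rwa [hψ0] at this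
  set B1 := pb φ B with hB1
  have sB1 : ContDiff ℝ ∞ B1 := pb_contDiff hφ hB
  have good : ∀ᶠ p in 𝓝 (0 : H × ℝ), ClosedAt B1 p ∧ SkewAt B1 p ∧ ∀ v, B1 p (0, 1) v = 0 := by
    filter_upwards [cφ.eventually hc, cφ.eventually hs, cφ.eventually hBX, hcol] with p h1 h2 h3 h4
    refine ⟨pb_closed hφ hB h2 h1, pb_skew h2, fun v => ?_⟩
    rw [hB1, pb_apply, h4, h3]
  obtain ⟨r, hr0, hball⟩ := Metric.eventually_nhds_iff_ball.1 good
  have hder : ∀ p ∈ Metric.ball (0 : H × ℝ) r, ∀ v w, fderiv ℝ B1 p (0, 1) v w = 0 := by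
    intro p hp v w
    obtain ⟨h1, -, -⟩ := hball p hp
    have dB : DifferentiableAt ℝ B1 p := sB1.differentiable (by simp) p
    have e1 : fderiv ℝ B1 p v w (0, 1) = 0 := by
      rw [← fderiv_apply₂ dB]
      have : (fun y => B1 y w (0, 1)) =ᶠ[𝓝 p] fun _ => 0 := by
        filter_upwards [Metric.isOpen_ball.mem_nhds hp] with y hy
        rw [(hball y hy).2.1, (hball y hy).2.2, neg_zero]
      rw [this.fderiv_eq]; simp
    have e2 : fderiv ℝ B1 p w (0, 1) v = 0 := by
      rw [← fderiv_apply₂ dB]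
      have : (fun y => B1 y (0, 1) v) =ᶠ[𝓝 p] fun _ => 0 := by
        filter_upwards [Metric.isOpen_ball.mem_nhds hp] with y hy
        rw [(hball y hy).2.2]
      rw [this.fderiv_eq]; simp
    have := h1 (0, 1) v w
    rw [e1, e2] at this
    linarith
  have hconst : ∀ p ∈ Metric.ball (0 : H × ℝ) r, ∀ v w, B1 p v w = B1 (p.1, 0) v w := by
    intro p hp v w
    rw [← Prod.mk_zero_zero, ← ball_prod_same] at hp
    have hin : ∀ t ∈ Metric.ball (0:ℝ) r, (p.1, t) ∈ Metric.ball (0 : H × ℝ) r := by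
      intro t ht
      rw [← Prod.mk_zero_zero, ← ball_prod_same]; exact ⟨hp.1, ht⟩
    have hd : ∀ t ∈ Metric.ball (0:ℝ) r, HasDerivAt (fun t => B1 (p.1, t) v w) 0 t := by
      intro t ht
      have dB : DifferentiableAt ℝ B1 (p.1, t) := sB1.differentiable (by simp) _
      have dB' : DifferentiableAt ℝ (fun y => B1 y v w) (p.1, t) :=
        (dB.clm_apply (differentiableAt_const v)).clm_apply (differentiableAt_const w)
      have h2 : HasDerivAt (fun s : ℝ => (p.1, s)) ((0 : H), (1 : ℝ)) t :=
        (hasDerivAt_const _ _).prodMk (hasDerivAt_id _)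
      have h3 := dB'.hasFDerivAt.comp_hasDerivAt t h2
      rw [fderiv_apply₂ dB, hder _ (hin t ht)] at h3
      exact h3
    exact (convex_ball (0:ℝ) r).is_const_of_fderivWithin_eq_zero (𝕜 := ℝ)
      (f := fun t => B1 (p.1, t) v w)
      (fun t ht => (hd t ht).differentiableAt.differentiableWithinAt)
      (fun t ht => by
        rw [fderivWithin_of_isOpen Metric.isOpen_ball ht]
        refine ((hd t ht).hasFDerivAt.fderiv).trans ?_
        ext; simp) hp.2 (Metric.mem_ball_self hr0)
  let ι : H → H × ℝ := fun z => (z, 0)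
  have hι : ContDiff ℝ ∞ ι := contDiff_id.prodMk contDiff_const
  have dι : ∀ z, fderiv ℝ ι z = ContinuousLinearMap.inl ℝ H ℝ := fun z =>
    (ContinuousLinearMap.inl ℝ H ℝ).hasFDerivAt.fderiv
  have cι : Tendsto ι (𝓝 0) (𝓝 0) := hι.continuous.tendsto 0
  refine ⟨fun x => (ψ x).1, pb ι B1, contDiff_fst.comp hψ, by simp [hψ0], pb_contDiff hι sB1, ?_, ?_, ?_⟩
  · filter_upwards [cι.eventually good] with z hz
    exact pb_closed hι sB1 hz.2.1 hz.1
  · filter_upwards [cι.eventually good] with z hz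
    exact pb_skew hz.2.1
  · filter_upwards [hr, hr.eventually_nhds, cψ.eventually (Metric.ball_mem_nhds _ hr0)] with x h1 h2 h3
    intro u v
    have d1 : HasFDerivAt (fun x => (ψ x).1) ((ContinuousLinearMap.fst ℝ _ _).comp (fderiv ℝ ψ x)) x :=
      (hψ.differentiable (by simp) x).hasFDerivAt.fst
    have dφ : HasFDerivAt φ (fderiv ℝ φ (ψ x)) (ψ x) := (hφ.differentiable (by simp) _).hasFDerivAt
    have dψ : HasFDerivAt ψ (fderiv ℝ ψ x) x := (hψ.differentiable (by simp) _).hasFDerivAt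
    have d2 := dφ.comp x dψ
    have d3 : HasFDerivAt (φ ∘ ψ) (ContinuousLinearMap.id ℝ _) x :=
      (hasFDerivAt_id _).congr_of_eventuallyEq h2
    have hid : ∀ u, fderiv ℝ φ (ψ x) (fderiv ℝ ψ x u) = u := fun u =>
      congrArg (fun L : E →L[ℝ] E => L u) (d2.unique d3)
    have e1 : B x u v = B1 (ψ x) (fderiv ℝ ψ x u) (fderiv ℝ ψ x v) := by
      rw [hB1, pb_apply, hid, hid, h1]
    obtain ⟨-, hsk, hk⟩ := hball _ h3
    have e2 : ∀ a b : H × ℝ, B1 (ψ x) a b = B1 (ψ x) (a.1, 0) (b.1, 0) := by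
      intro a b
      have ea : a = (a.1, 0) + a.2 • ((0 : H), (1:ℝ)) := by ext <;> simp
      have eb : b = (b.1, 0) + b.2 • ((0 : H), (1:ℝ)) := by ext <;> simp
      have z1 : B1 (ψ x) (a.1, 0) (0, 1) = 0 := by rw [hsk, hk, neg_zero]
      conv_lhs => rw [ea, eb]
      simp only [map_add, map_smul, add_apply, smul_apply, hk, z1,
        smul_zero, add_zero]
    have e3 : ∀ z a b, pb ι B1 z a b = B1 (z, 0) (a, 0) (b, 0) := by
      intro z a b
      rw [pb_apply ι B1, dι]
      rfl
    rw [e1, e2, hconst _ h3, pb_apply _ (pb ι B1), e3, d1.fderiv]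
    rfl

/-- `dp ∧ dq` -/
noncomputable def wdg (p q : E → ℝ) : E → E →L[ℝ] E →L[ℝ] ℝ :=
  pb (fun x => (p x, q x)) (fun _ => (ContinuousLinearMap.fst ℝ ℝ ℝ).smulRight (ContinuousLinearMap.snd ℝ ℝ ℝ)
    - (ContinuousLinearMap.snd ℝ ℝ ℝ).smulRight (ContinuousLinearMap.fst ℝ ℝ ℝ))

theorem wdg_apply {p q : E → ℝ} {x : E} (hp : DifferentiableAt ℝ p x) (hq : DifferentiableAt ℝ q x)
    (u v : E) : wdg p q x u v = fderiv ℝ p x u * fderiv ℝ q x v - fderiv ℝ q x u * fderiv ℝ p x v := by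
  rw [wdg, pb_apply, hp.fderiv_prodMk hq]
  simp

theorem wdg_contDiff {p q : E → ℝ} (hp : ContDiff ℝ ∞ p) (hq : ContDiff ℝ ∞ q) :
    ContDiff ℝ ∞ (wdg p q) := pb_contDiff (hp.prodMk hq) contDiff_const

theorem wdg_skew {p q : E → ℝ} (x : E) : SkewAt (wdg p q) x :=
  pb_skew (fun u v => by simp; ring)

theorem wdg_closed {p q : E → ℝ} (hp : ContDiff ℝ ∞ p) (hq : ContDiff ℝ ∞ q) (x : E) :
    ClosedAt (wdg p q) x :=
  pb_closed (hp.prodMk hq) contDiff_const (fun u v => by simp; ring) (fun u v w => by simp)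

theorem wdg_comp {ρ : E → H} {F1 F2 : H → ℝ} (hρ : ContDiff ℝ ∞ ρ) (h1 : ContDiff ℝ ∞ F1)
    (h2 : ContDiff ℝ ∞ F2) {B : E → E →L[ℝ] E →L[ℝ] ℝ} {B' : H → H →L[ℝ] H →L[ℝ] ℝ} {x₀ : E}
    (h0 : ρ x₀ = 0) (hB : ∀ᶠ x in 𝓝 x₀, ∀ u v, B x u v = pb ρ B' x u v)
    (hB' : ∀ᶠ z in 𝓝 0, ∀ u v, B' z u v = wdg F1 F2 z u v) :
    ∀ᶠ x in 𝓝 x₀, ∀ u v, B x u v = wdg (F1 ∘ ρ) (F2 ∘ ρ) x u v := by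
  have cρ : Tendsto ρ (𝓝 x₀) (𝓝 0) := by
    have := hρ.continuous.tendsto x₀
    rwa [h0] at this
  filter_upwards [hB, cρ.eventually hB'] with x e1 e2
  intro u v
  have d1 := h1.differentiable (by simp) (ρ x)
  have d2 := h2.differentiable (by simp) (ρ x)
  have d := hρ.differentiable (by simp) x
  rw [e1, pb_apply, e2, wdg_apply d1 d2, wdg_apply (d1.comp x d) (d2.comp x d),
    fderiv_comp x d1 d, fderiv_comp x d2 d]
  rfl

theorem bil_two (b : (Fin 2 → ℝ) →L[ℝ] (Fin 2 → ℝ) →L[ℝ] ℝ) (hs : ∀ u v, b u v = - b v u)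
    (u v : Fin 2 → ℝ) :
    b u v = b (Pi.single 0 1) (Pi.single 1 1) * (u 0 * v 1 - u 1 * v 0) := by
  have hd : ∀ u : Fin 2 → ℝ, u = u 0 • (Pi.single 0 1 : Fin 2 → ℝ) + u 1 • (Pi.single 1 1 : Fin 2 → ℝ) := by
    intro u; ext i; fin_cases i <;> simp
  have h0 := hs (Pi.single 0 1) (Pi.single 0 1)
  have h1 := hs (Pi.single 1 1) (Pi.single 1 1)
  have h2 := hs (Pi.single 1 1) (Pi.single 0 1)
  have h0' : b (Pi.single 0 1) (Pi.single 0 1) = 0 := by linarith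
  have h1' : b (Pi.single 1 1) (Pi.single 1 1) = 0 := by linarith
  conv_lhs => rw [hd u, hd v]
  simp only [map_add, map_smul, add_apply, smul_apply, smul_eq_mul,
    h0', h1', h2]
  ring

theorem darboux_two (B : (Fin 2 → ℝ) → (Fin 2 → ℝ) →L[ℝ] (Fin 2 → ℝ) →L[ℝ] ℝ) (hB : ContDiff ℝ ∞ B)
    (hs : ∀ᶠ z in 𝓝 0, SkewAt B z) (h0 : B 0 ≠ 0) :
    ∃ F1 F2 : (Fin 2 → ℝ) → ℝ, ContDiff ℝ ∞ F1 ∧ ContDiff ℝ ∞ F2 ∧ F1 0 = 0 ∧ F2 0 = 0 ∧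
      ∀ᶠ z in 𝓝 0, ∀ u v, B z u v = wdg F1 F2 z u v := by
  let g : (Fin 2 → ℝ) → ℝ := fun z => B z (Pi.single 0 1) (Pi.single 1 1)
  have hg : ContDiff ℝ ∞ g := (hB.clm_apply contDiff_const).clm_apply contDiff_const
  have hg0 : g 0 ≠ 0 := by
    intro h
    apply h0
    ext u v
    rw [bil_two (B 0) hs.self_of_nhds]
    change g 0 * _ = _
    rw [h]; simp
  have hgn : ∀ᶠ z in 𝓝 0, g z ≠ 0 := hg.continuous.continuousAt.eventually_ne hg0
  obtain ⟨X, hX, hXe⟩ := exists_global_smooth (f := fun z => (g z)⁻¹ • (Pi.single 0 1 : Fin 2 → ℝ))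
    (W := {z | g z ≠ 0}) hgn (fun z hz =>
      ((hg.contDiffAt.inv hz).smul contDiffAt_const).contDiffWithinAt)
  obtain ⟨q, hq, hq0, hqd⟩ := exists_time (by simp) X hX 0 (by
    rw [hXe.self_of_nhds]
    intro h
    have := congrFun h 0
    simp [hg0] at this)
  refine ⟨q, fun z => z 1, hq, contDiff_apply ℝ ℝ 1, hq0, rfl, ?_⟩
  filter_upwards [hs, hgn, hXe, hqd] with z h1 h2 h3 h4
  intro u v
  have dp : fderiv ℝ (fun z : Fin 2 → ℝ => z 1) z = ContinuousLinearMap.proj 1 :=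
    (ContinuousLinearMap.proj (R := ℝ) (φ := fun _ : Fin 2 => ℝ) 1).hasFDerivAt.fderiv
  rw [h3, map_smul, smul_eq_mul, inv_mul_eq_one₀ h2] at h4
  rw [bil_two (B z) h1, wdg_apply (hq.differentiable (by simp) z)
    ((contDiff_apply ℝ ℝ 1 (n := ∞)).differentiable (by simp) z), dp]
  have hd : ∀ u : Fin 2 → ℝ, u = u 0 • (Pi.single 0 1 : Fin 2 → ℝ) + u 1 • (Pi.single 1 1 : Fin 2 → ℝ) := by
    intro u; ext i; fin_cases i <;> simp
  have e : ∀ u, fderiv ℝ q z u = u 0 * g z + u 1 * fderiv ℝ q z (Pi.single 1 1) := by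
    intro u
    conv_lhs => rw [hd u]
    rw [map_add, map_smul, map_smul, ← h4]; rfl
  rw [e u, e v]
  change g z * _ = _
  simp only [ContinuousLinearMap.proj_apply]
  ring

theorem darboux_three (B : (Fin 3 → ℝ) → (Fin 3 → ℝ) →L[ℝ] (Fin 3 → ℝ) →L[ℝ] ℝ) (hB : ContDiff ℝ ∞ B)
    (hc : ∀ᶠ z in 𝓝 0, ClosedAt B z) (hs : ∀ᶠ z in 𝓝 0, SkewAt B z) (h0 : B 0 ≠ 0) :
    ∃ F1 F2 : (Fin 3 → ℝ) → ℝ, ContDiff ℝ ∞ F1 ∧ ContDiff ℝ ∞ F2 ∧ F1 0 = 0 ∧ F2 0 = 0 ∧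
      ∀ᶠ z in 𝓝 0, ∀ u v, B z u v = wdg F1 F2 z u v := by
  let b : (Fin 3 → ℝ) → Fin 3 → Fin 3 → ℝ := fun z i j => B z (Pi.single i 1) (Pi.single j 1)
  have hb : ∀ i j, ContDiff ℝ ∞ fun z => b z i j := fun i j =>
    (hB.clm_apply contDiff_const).clm_apply contDiff_const
  let Y : (Fin 3 → ℝ) → Fin 3 → ℝ := fun z => ![b z 1 2, b z 2 0, b z 0 1]
  have hY : ContDiff ℝ ∞ Y := by
    rw [contDiff_pi]
    intro i
    fin_cases i
    · exact hb 1 2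
    · exact hb 2 0
    · exact hb 0 1
  have hd : ∀ u : Fin 3 → ℝ, u = u 0 • (Pi.single 0 1 : Fin 3 → ℝ) + u 1 • (Pi.single 1 1 : Fin 3 → ℝ)
      + u 2 • (Pi.single 2 1 : Fin 3 → ℝ) := by
    intro u; ext i; fin_cases i <;> simp
  have hexp : ∀ z, SkewAt B z → ∀ u v, B z u v = b z 1 2 * (u 1 * v 2 - u 2 * v 1) +
      b z 2 0 * (u 2 * v 0 - u 0 * v 2) + b z 0 1 * (u 0 * v 1 - u 1 * v 0) := by
    intro z hz u v
    have h0 := hz (Pi.single 0 1) (Pi.single 0 1)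
    have h1 := hz (Pi.single 1 1) (Pi.single 1 1)
    have h2 := hz (Pi.single 2 1) (Pi.single 2 1)
    have h0' : B z (Pi.single 0 1) (Pi.single 0 1) = 0 := by linarith
    have h1' : B z (Pi.single 1 1) (Pi.single 1 1) = 0 := by linarith
    have h2' : B z (Pi.single 2 1) (Pi.single 2 1) = 0 := by linarith
    conv_lhs => rw [hd u, hd v]
    simp only [map_add, map_smul, add_apply, smul_apply, smul_eq_mul,
      h0', h1', h2', hz (Pi.single 1 1) (Pi.single 0 1), hz (Pi.single 2 1) (Pi.single 1 1),
      hz (Pi.single 0 1) (Pi.single 2 1), b]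
    ring
  have hY0 : Y 0 ≠ 0 := by
    intro h
    apply h0
    have a0 : b 0 1 2 = 0 := congrFun h 0
    have a1 : b 0 2 0 = 0 := congrFun h 1
    have a2 : b 0 0 1 = 0 := congrFun h 2
    ext u v
    rw [hexp 0 hs.self_of_nhds, a0, a1, a2]; simp
  have hBY : ∀ᶠ z in 𝓝 0, ∀ v, B z (Y z) v = 0 := by
    filter_upwards [hs] with z hz
    intro v
    rw [hexp z hz]
    simp [Y]
    ring
  obtain ⟨ρ, B', hρ, hρ0, hB', -, hs', he⟩ :=
    reduce (H := Fin 2 → ℝ) (by simp) Y hY 0 hY0 B hB hc hs hBY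
  obtain ⟨F1, F2, h1, h2, h10, h20, hF⟩ := darboux_two B' hB' hs' (by
    intro h
    apply h0
    ext u v
    rw [he.self_of_nhds, pb_apply, hρ0, h]; simp)
  exact ⟨F1 ∘ ρ, F2 ∘ ρ, h1.comp hρ, h2.comp hρ, by simp [hρ0, h10], by simp [hρ0, h20],
    wdg_comp hρ h1 h2 hρ0 he hF⟩

theorem darboux_four (hdim : Module.finrank ℝ E = 4) (σ : E → E →L[ℝ] E →L[ℝ] ℝ) (hσ : ContDiff ℝ ∞ σ)
    (x₀ : E) (hc : ∀ᶠ x in 𝓝 x₀, ClosedAt σ x) (hs : ∀ᶠ x in 𝓝 x₀, SkewAt σ x)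
    (hnd : ∀ u, (∀ v, σ x₀ u v = 0) → u = 0) (p : E → ℝ) (hp : ContDiff ℝ ∞ p)
    (hp0 : fderiv ℝ p x₀ ≠ 0) :
    ∃ F1 F2 q : E → ℝ, ContDiff ℝ ∞ F1 ∧ ContDiff ℝ ∞ F2 ∧ ContDiff ℝ ∞ q ∧
      F1 x₀ = 0 ∧ F2 x₀ = 0 ∧ q x₀ = 0 ∧
      ∀ᶠ x in 𝓝 x₀, ∀ u v, σ x u v = wdg F1 F2 x u v + wdg p q x u v := by
  have : CompleteSpace E := FiniteDimensional.complete ℝ E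
  have hdual : Module.finrank ℝ E = Module.finrank ℝ (E →L[ℝ] ℝ) := by
    rw [LinearMap.toContinuousLinearMap.symm.finrank_eq]
    exact Subspace.dual_finrank_eq.symm
  have hinj : Function.Injective (σ x₀ : E →ₗ[ℝ] (E →L[ℝ] ℝ)) := by
    rw [injective_iff_map_eq_zero]
    intro u hu
    apply hnd
    intro v
    exact congrArg (fun L : E →L[ℝ] ℝ => L v) hu
  let S : E ≃L[ℝ] (E →L[ℝ] ℝ) :=
    (LinearMap.linearEquivOfInjective _ hinj hdual).toContinuousLinearEquiv
  have hS : (S : E →L[ℝ] (E →L[ℝ] ℝ)) = σ x₀ := rfl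
  have hopen : IsOpen {x | σ x ∈ Set.range ((↑) : (E ≃L[ℝ] (E →L[ℝ] ℝ)) → E →L[ℝ] (E →L[ℝ] ℝ))} :=
    (ContinuousLinearEquiv.isOpen (𝕜 := ℝ) (E := E) (F := E →L[ℝ] ℝ)).preimage hσ.continuous
  have hdp : ContDiff ℝ ∞ (fderiv ℝ p) := hp.fderiv_right (by simp)
  have hmem := hopen.mem_nhds (x := x₀) ⟨S, hS⟩
  obtain ⟨X, hX, hXe⟩ := exists_global_smooth
    (f := fun x => -(ContinuousLinearMap.inverse (σ x) (fderiv ℝ p x))) hmem (fun x hx => by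
      obtain ⟨e, he⟩ := hx
      have h1 : ContDiffAt ℝ ∞ (ContinuousLinearMap.inverse : (E →L[ℝ] (E →L[ℝ] ℝ)) → _) (σ x) := by
        rw [← he]; exact contDiffAt_map_inverse e
      have h2 : ContDiffAt ℝ ∞ (fun x => ContinuousLinearMap.inverse (σ x)) x :=
        ContDiffAt.comp (f := σ) x h1 hσ.contDiffAt
      exact (h2.clm_apply hdp.contDiffAt).neg.contDiffWithinAt)
  have hXσ : ∀ᶠ x in 𝓝 x₀, ∀ v, σ x (X x) v = - fderiv ℝ p x v := by
    filter_upwards [hXe, hmem] with x h1 h2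
    obtain ⟨e, he⟩ := h2
    intro v
    rw [h1, ← he, ContinuousLinearMap.inverse_equiv]
    simp
  have hX0 : X x₀ ≠ 0 := by
    intro h
    apply hp0
    ext v
    have := hXσ.self_of_nhds v
    rw [h] at this
    simp at this
    simp [this]
  obtain ⟨q, hq, hq0, hqX⟩ := exists_time (by omega) X hX x₀ hX0
  let τ : E → E →L[ℝ] E →L[ℝ] ℝ := fun x => σ x - wdg p q x
  have hτ : ContDiff ℝ ∞ τ := hσ.sub (wdg_contDiff hp hq)
  have dp : ∀ x, DifferentiableAt ℝ p x := hp.differentiable (by simp)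
  have dq : ∀ x, DifferentiableAt ℝ q x := hq.differentiable (by simp)
  have hτX : ∀ᶠ x in 𝓝 x₀, ∀ v, τ x (X x) v = 0 := by
    filter_upwards [hXσ, hqX, hs] with x h1 h2 h3
    intro v
    have h4 := h1 (X x)
    have h5 := h3 (X x) (X x)
    change σ x (X x) v - wdg p q x (X x) v = 0
    rw [wdg_apply (dp x) (dq x), h1, h2]
    have : fderiv ℝ p x (X x) = 0 := by linarith
    rw [this]; ring
  have hτs : ∀ᶠ x in 𝓝 x₀, SkewAt τ x := by
    filter_upwards [hs] with x h u v
    change σ x u v - wdg p q x u v = -(σ x v u - wdg p q x v u)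
    rw [h u v, wdg_skew x u v]; ring
  have hτc : ∀ᶠ x in 𝓝 x₀, ClosedAt τ x := by
    filter_upwards [hc] with x h u v w
    have hsub : ∀ u v w, fderiv ℝ τ x u v w = fderiv ℝ σ x u v w - fderiv ℝ (wdg p q) x u v w := by
      intro u v w
      have d1 := hσ.differentiable (by simp) x
      have d2 := (wdg_contDiff hp hq).differentiable (by simp) x
      rw [← fderiv_apply₂ d1, ← fderiv_apply₂ d2, ← fderiv_apply₂ (hτ.differentiable (by simp) x)]
      have d3 : DifferentiableAt ℝ (fun y => σ y v w) x :=
        (d1.clm_apply (differentiableAt_const v)).clm_apply (differentiableAt_const w)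
      have d4 : DifferentiableAt ℝ (fun y => wdg p q y v w) x :=
        (d2.clm_apply (differentiableAt_const v)).clm_apply (differentiableAt_const w)
      have e : (fun y => τ y v w) = fun y => σ y v w - wdg p q y v w := rfl
      rw [e, fderiv_fun_sub d3 d4]
      rfl
    rw [hsub, hsub, hsub]
    have h1 := h u v w
    have h2 := wdg_closed hp hq x u v w
    linarith
  obtain ⟨ρ, B', hρ, hρ0, hB', hc', hs', he⟩ :=
    reduce (H := Fin 3 → ℝ) (by simp [hdim]) X hX x₀ hX0 τ hτ hτc hτs hτX
  obtain ⟨F1, F2, h1, h2, h10, h20, hF⟩ := darboux_three B' hB' hc' hs' (by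
    intro h
    -- then `σ x₀ = dp ∧ dq` is degenerate
    have hz : ∀ u v, σ x₀ u v = wdg p q x₀ u v := by
      intro u v
      have := he.self_of_nhds u v
      rw [pb_apply, hρ0, h] at this
      change σ x₀ u v - wdg p q x₀ u v = 0 at this
      linarith
    let L : E →ₗ[ℝ] ℝ × ℝ := ((fderiv ℝ p x₀).prod (fderiv ℝ q x₀) : E →L[ℝ] ℝ × ℝ)
    have hL : Function.Injective L := by
      rw [injective_iff_map_eq_zero]
      intro u hu
      apply hnd
      intro v
      have a1 : fderiv ℝ p x₀ u = 0 := congrArg Prod.fst hu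
      have a2 : fderiv ℝ q x₀ u = 0 := congrArg Prod.snd hu
      rw [hz, wdg_apply (dp _) (dq _), a1, a2]; ring
    have := LinearMap.finrank_le_finrank_of_injective hL
    simp [hdim] at this)
  refine ⟨F1 ∘ ρ, F2 ∘ ρ, q, h1.comp hρ, h2.comp hρ, hq, by simp [hρ0, h10], by simp [hρ0, h20], hq0, ?_⟩
  filter_upwards [wdg_comp hρ h1 h2 hρ0 he hF] with x hx u v
  rw [← hx]
  change σ x u v = σ x u v - wdg p q x u v + wdg p q x u v
  ring

end reduction

section main

theorem covec_apply (c : Fin 4 → ℝ) (v : Pt) : covec c v = ∑ i, c i * v i := by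
  simp [covec]

theorem d1_skew (θ : Form1) (x : Pt) (i j : Fin 4) : d1 θ x i j = - d1 θ x j i := by
  simp [d1]

theorem class_one (θ : Form1) (x : Pt) (h0 : θ x ≠ 0) (hc : classAt θ x = 1) (i j : Fin 4) :
    d1 θ x i j = 0 := by
  obtain ⟨k, hk⟩ := Function.ne_iff.1 h0
  simp only [Pi.zero_apply] at hk
  have hK : LinearMap.ker (covec (θ x)) ⊓ ⨅ j, LinearMap.ker (covec (fun i => d1 θ x i j)) =
      LinearMap.ker (covec (θ x)) := by
    apply Submodule.eq_of_le_of_finrank_le inf_le_left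
    have h1 : Module.finrank ℝ (LinearMap.ker (covec (θ x))) < 4 := by
      have h4 : Module.finrank ℝ Pt = 4 := by simp [Pt]
      refine lt_of_lt_of_eq ?_ h4
      apply Submodule.finrank_lt
      intro htop
      have : (Pi.single k 1 : Pt) ∈ LinearMap.ker (covec (θ x)) := by rw [htop]; trivial
      rw [LinearMap.mem_ker, covec_apply] at this
      simp [Pi.single_apply] at this
      exact hk this
    unfold classAt at hc
    omega
  have hrel : ∀ i j, θ x k * d1 θ x i j = θ x i * d1 θ x k j := by
    intro i j
    let v : Pt := θ x k • Pi.single i 1 - θ x i • Pi.single k 1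
    have hv : ∀ c : Fin 4 → ℝ, covec c v = θ x k * c i - θ x i * c k := by
      intro c
      rw [covec_apply]
      simp [v, mul_sub, Finset.sum_sub_distrib, Pi.single_apply]
      ring
    have hm : v ∈ LinearMap.ker (covec (θ x)) := by
      rw [LinearMap.mem_ker, hv]; ring
    rw [← hK, Submodule.mem_inf, Submodule.mem_iInf] at hm
    have := hm.2 j
    rw [LinearMap.mem_ker, hv] at this
    linarith
  have hkk : d1 θ x k k = 0 := by have := d1_skew θ x k k; linarith
  have hjk : ∀ j, d1 θ x j k = 0 := by
    intro j
    have := hrel j k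
    rw [hkk, mul_zero] at this
    exact (mul_eq_zero.1 this).resolve_left hk
  have := hrel i j
  rw [d1_skew θ x k j, hjk j, neg_zero, mul_zero] at this
  exact (mul_eq_zero.1 this).resolve_left hk

theorem vec_decomp (u : Pt) : u = ∑ i, u i • (Pi.single i 1 : Pt) := by
  ext j
  simp [Finset.sum_apply, Pi.single_apply]

theorem fderiv_eq_sum (f : Pt → ℝ) (x u : Pt) : fderiv ℝ f x u = ∑ i, u i * pd i f x := by
  conv_lhs => rw [vec_decomp u]
  simp [pd]

theorem pd_congr {f g : Pt → ℝ} {x : Pt} (h : f =ᶠ[𝓝 x] g) (i : Fin 4) : pd i f x = pd i g x := by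
  rw [pd, pd, h.fderiv_eq]

theorem exists_potential (g : Form1) (hg : ContDiff ℝ ∞ g) (x₀ : Pt)
    (hd : ∀ᶠ x in 𝓝 x₀, ∀ i j, d1 g x i j = 0) :
    ∃ f : Pt → ℝ, ContDiff ℝ ∞ f ∧ f x₀ = 0 ∧ ∀ᶠ x in 𝓝 x₀, ∀ i, pd i f x = g x i := by
  obtain ⟨r, hr, hball⟩ := Metric.eventually_nhds_iff_ball.1 hd
  let α : Pt → Pt →L[ℝ] ℝ := fun x => ∑ i, g x i • ContinuousLinearMap.proj i
  have hgi : ∀ i, ContDiff ℝ ∞ fun x => g x i := fun i => contDiff_pi.1 hg i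
  have hα : ContDiff ℝ ∞ α := ContDiff.sum fun i _ => (hgi i).smul contDiff_const
  have hαa : ∀ x v, α x v = ∑ i, g x i * v i := by intro x v; simp [α]
  have hαd : ∀ x u v, fderiv ℝ α x u v = ∑ j, ∑ i, u i * v j * pd i (fun y => g y j) x := by
    intro x u v
    have h1 : fderiv ℝ α x u v = fderiv ℝ (fun y => α y v) x u := by
      have h := (hα.differentiable (by simp) x).hasFDerivAt.clm_apply (hasFDerivAt_const v x)
      rw [h.fderiv]; simp
    rw [h1, fderiv_eq_sum, Finset.sum_comm]
    refine Finset.sum_congr rfl fun i _ => ?_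
    have h2 : pd i (fun y => α y v) x = ∑ j, pd i (fun y => g y j) x * v j := by
      have e : (fun y => α y v) = fun y => ∑ j, g y j * v j := by ext y; exact hαa y v
      rw [e, pd, fderiv_fun_sum (fun j _ => ((hgi j).differentiable (by simp) x).mul_const _)]
      simp only [sum_apply]
      refine Finset.sum_congr rfl fun j _ => ?_
      rw [fderiv_mul_const ((hgi j).differentiable (by simp) x)]
      simp [pd, mul_comm]
    rw [h2, Finset.mul_sum]
    exact Finset.sum_congr rfl fun j _ => by ring
  obtain ⟨f, hf⟩ := (convex_ball x₀ r).exists_forall_hasFDerivAt_of_fderiv_symmetric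
    Metric.isOpen_ball (hα.differentiable (by simp)).differentiableOn (by
      intro a ha x y
      rw [hαd, hαd, Finset.sum_comm]
      refine Finset.sum_congr rfl fun i _ => Finset.sum_congr rfl fun j _ => ?_
      have := hball a ha i j
      unfold d1 at this
      rw [sub_eq_zero.1 this]; ring)
  have hfs : ContDiffOn ℝ ∞ f (Metric.ball x₀ r) := by
    rw [contDiffOn_infty_iff_fderiv_of_isOpen Metric.isOpen_ball]
    refine ⟨fun x hx => (hf x hx).differentiableAt.differentiableWithinAt, ?_⟩
    exact hα.contDiffOn.congr fun x hx => (hf x hx).fderiv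
  obtain ⟨F, hF, hFe⟩ := exists_global_smooth (Metric.ball_mem_nhds x₀ hr) hfs
  refine ⟨fun x => F x - F x₀, hF.sub contDiff_const, sub_self _, ?_⟩
  filter_upwards [hFe.eventually_nhds, Metric.ball_mem_nhds x₀ hr] with x h1 h2 i
  rw [pd, fderiv_sub_const, EventuallyEq.fderiv_eq h1, (hf x h2).fderiv, hαa]
  simp [Pi.single_apply]

/-- coordinate 2-form as a bilinear-form-valued map -/
noncomputable def toB (c : Form2) : Pt → Pt →L[ℝ] Pt →L[ℝ] ℝ := fun x =>
  ∑ i, ∑ j, c x i j • (ContinuousLinearMap.proj i : Pt →L[ℝ] ℝ).smulRight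
    (ContinuousLinearMap.proj j : Pt →L[ℝ] ℝ)

theorem toB_apply (c : Form2) (x u v : Pt) : toB c x u v = ∑ i, ∑ j, c x i j * u i * v j := by
  simp [toB, mul_assoc]

theorem toB_contDiff {c : Form2} (hc : ContDiff ℝ ∞ c) : ContDiff ℝ ∞ (toB c) := by
  rw [contDiff_clm_apply_iff]
  intro u
  rw [contDiff_clm_apply_iff]
  intro v
  simp only [toB_apply]
  exact ContDiff.sum fun i _ => ContDiff.sum fun j _ =>
    ((contDiff_pi.1 (contDiff_pi.1 hc i) j).mul contDiff_const).mul contDiff_const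

theorem toB_skew {c : Form2} {x : Pt} (h : ∀ i j, c x i j = - c x j i) : SkewAt (toB c) x := by
  intro u v
  rw [toB_apply, toB_apply, Finset.sum_comm, ← Finset.sum_neg_distrib]
  refine Finset.sum_congr rfl fun i _ => ?_
  rw [← Finset.sum_neg_distrib]
  refine Finset.sum_congr rfl fun j _ => ?_
  rw [h j i]; ring

theorem toB_closed {c : Form2} (hc : ContDiff ℝ ∞ c) {x : Pt}
    (h : ∀ᶠ y in 𝓝 x, ∀ i j, c y i j = - c y j i) (hd : ∀ i j k, d2 c x i j k = 0) :
    ClosedAt (toB c) x := by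
  have hcij : ∀ i j, Differentiable ℝ fun y => c y i j := fun i j =>
    (contDiff_pi.1 (contDiff_pi.1 hc i) j).differentiable (by simp)
  have key : ∀ u v w, fderiv ℝ (toB c) x u v w =
      ∑ i, ∑ j, ∑ k, u i * v j * w k * pd i (fun y => c y j k) x := by
    intro u v w
    rw [← fderiv_apply₂ ((toB_contDiff hc).differentiable (by simp) x), fderiv_eq_sum]
    refine Finset.sum_congr rfl fun i _ => ?_
    have e : (fun y => toB c y v w) = fun y => ∑ j, ∑ k, c y j k * (v j * w k) := by
      ext y; rw [toB_apply]; simp [mul_assoc]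
    have h2 : pd i (fun y => toB c y v w) x = ∑ j, ∑ k, pd i (fun y => c y j k) x * (v j * w k) := by
      rw [e, pd, fderiv_fun_sum (fun j _ => DifferentiableAt.fun_sum fun k _ => (hcij j k x).mul_const _)]
      simp only [sum_apply]
      refine Finset.sum_congr rfl fun j _ => ?_
      rw [fderiv_fun_sum (fun k _ => (hcij j k x).mul_const _)]
      simp only [sum_apply]
      refine Finset.sum_congr rfl fun k _ => ?_
      rw [fderiv_mul_const (hcij j k x)]
      simp [pd, mul_comm]
    rw [h2, Finset.mul_sum]
    refine Finset.sum_congr rfl fun j _ => ?_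
    rw [Finset.mul_sum]
    exact Finset.sum_congr rfl fun k _ => by ring
  intro u v w
  have e2 : fderiv ℝ (toB c) x v w u = ∑ i, ∑ j, ∑ k, u i * v j * w k * pd j (fun y => c y k i) x := by
    rw [key]
    calc _ = ∑ j, ∑ i, ∑ k, u i * v j * w k * pd j (fun y => c y k i) x := by
          refine Finset.sum_congr rfl fun j _ => ?_
          rw [Finset.sum_comm]
          exact Finset.sum_congr rfl fun i _ => Finset.sum_congr rfl fun k _ => by ring
      _ = _ := Finset.sum_comm
  have e3 : fderiv ℝ (toB c) x w u v = ∑ i, ∑ j, ∑ k, u i * v j * w k * pd k (fun y => c y i j) x := by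
    rw [key, Finset.sum_comm]
    refine Finset.sum_congr rfl fun i _ => ?_
    rw [Finset.sum_comm]
    exact Finset.sum_congr rfl fun j _ => Finset.sum_congr rfl fun k _ => by ring
  rw [key, e2, e3, ← Finset.sum_add_distrib, ← Finset.sum_add_distrib]
  refine Finset.sum_eq_zero fun i _ => ?_
  rw [← Finset.sum_add_distrib, ← Finset.sum_add_distrib]
  refine Finset.sum_eq_zero fun j _ => ?_
  rw [← Finset.sum_add_distrib, ← Finset.sum_add_distrib]
  refine Finset.sum_eq_zero fun k _ => ?_
  have hsk : pd j (fun y => c y k i) x = - pd j (fun y => c y i k) x := by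
    have : (fun y => c y k i) =ᶠ[𝓝 x] fun y => - c y i k := by
      filter_upwards [h] with y hy
      exact hy k i
    rw [pd_congr this, pd, fderiv_fun_neg]; rfl
  have := hd i j k
  unfold d2 at this
  rw [hsk]
  linear_combination (u i * v j * w k) * this

theorem pf_nondeg (c : Fin 4 → Fin 4 → ℝ) (hs : ∀ i j, c i j = - c j i) (u : Fin 4 → ℝ)
    (hu : ∀ j, ∑ i, c i j * u i = 0) (i j k l : Fin 4)
    (hp : c i j * c k l - c i k * c j l + c i l * c j k ≠ 0) (m : Fin 4) : u m = 0 := by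
  have hz : ∀ i, c i i = 0 := fun i => by have := hs i i; linarith
  have hij : i ≠ j := by
    rintro rfl; apply hp; rw [hz]; ring
  have hik : i ≠ k := by
    rintro rfl; apply hp; rw [hz, hs j i]; ring
  have hil : i ≠ l := by
    rintro rfl; apply hp; rw [hz, hs k i, hs j i]; ring
  have hjk : j ≠ k := by
    rintro rfl; apply hp; rw [hz]; ring
  have hjl : j ≠ l := by
    rintro rfl; apply hp; rw [hz, hs k j]; ring
  have hkl : k ≠ l := by
    rintro rfl; apply hp; rw [hz]; ring
  have huniv : (Finset.univ : Finset (Fin 4)) = {i, j, k, l} := by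
    clear hp hu
    revert i j k l; decide
  have hsum : ∀ n, c i n * u i + c j n * u j + c k n * u k + c l n * u l = 0 := by
    intro n
    have := hu n
    rw [huniv, Finset.sum_insert (by simp [hij, hik, hil]), Finset.sum_insert (by simp [hjk, hjl]),
      Finset.sum_insert (by simp [hkl]), Finset.sum_singleton] at this
    linarith
  have a1 := hsum i
  have a2 := hsum j
  have a3 := hsum k
  have a4 := hsum l
  rw [hz, hs j i, hs k i, hs l i] at a1
  rw [hz, hs k j, hs l j] at a2
  rw [hz, hs l k] at a3
  rw [hz] at a4
  have hm : m ∈ ({i, j, k, l} : Finset (Fin 4)) := by rw [← huniv]; simp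
  simp only [Finset.mem_insert, Finset.mem_singleton] at hm
  have fin : (c i j * c k l - c i k * c j l + c i l * c j k) * u m = 0 := by
    rcases hm with rfl | rfl | rfl | rfl
    · linear_combination c k l * a2 - c j l * a3 + c j k * a4
    · linear_combination - c k l * a1 + c i l * a3 - c i k * a4
    · linear_combination c j l * a1 - c i l * a2 + c i j * a4
    · linear_combination - c j k * a1 + c i k * a2 - c i j * a3
  exact (mul_eq_zero.1 fin).resolve_left hp

theorem toB_nondeg {c : Form2} {x : Pt} (hs : ∀ i j, c x i j = - c x j i) (hr : w22 c c x ≠ 0)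
    (u : Pt) (hu : ∀ v, toB c x u v = 0) : u = 0 := by
  have hu' : ∀ j, ∑ i, c x i j * u i = 0 := by
    intro j
    have := hu (Pi.single j 1)
    rw [toB_apply] at this
    simpa [Pi.single_apply] using this
  by_contra hne
  apply hr
  ext i j k l
  by_contra h
  apply hne
  ext m
  refine pf_nondeg (c x) hs u hu' i j k l ?_ m
  intro h2
  apply h
  simp only [w22, Pi.zero_apply]
  linear_combination 2 * h2

end main

section final

theorem normal_form_functions (W : Set Pt) (hW : IsOpen W) (x₀ : Pt) (hx₀ : x₀ ∈ W)
    (Ω : Form2) (hΩs : ContDiffOn ℝ ∞ Ω W)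
    (hΩa : ∀ x ∈ W, ∀ i j, Ω x i j = - Ω x j i)
    (hΩr : ∀ x ∈ W, w22 Ω Ω x ≠ 0)
    (θ : Form1) (hθs : ContDiffOn ℝ ∞ θ W)
    (hθ : ∀ x ∈ W, w12 θ Ω x = d2 Ω x)
    (htype : IsTypeAt θ 1 x₀) :
    ∃ F1 F2 f q : Pt → ℝ, ContDiff ℝ ∞ F1 ∧ ContDiff ℝ ∞ F2 ∧ ContDiff ℝ ∞ f ∧ ContDiff ℝ ∞ q ∧
      F1 x₀ = 0 ∧ F2 x₀ = 0 ∧ f x₀ = 0 ∧ q x₀ = 0 ∧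
      ∀ᶠ x in 𝓝 x₀, ∀ u v, toB Ω x u v = exp (f x) * wdg F1 F2 x u v + wdg f q x u v := by
  have hWn : ∀ᶠ x in 𝓝 x₀, x ∈ W := hW.mem_nhds hx₀
  obtain ⟨g, hg, hge⟩ := exists_global_smooth hWn hθs
  obtain ⟨A, hA, hAe⟩ := exists_global_smooth hWn hΩs
  have hne : ∀ᶠ x in 𝓝 x₀, θ x ≠ 0 := by
    have : ContinuousAt θ x₀ := (hθs.continuousOn).continuousAt hWn
    exact this.eventually_ne htype.1
  have hgd : ∀ᶠ x in 𝓝 x₀, ∀ i j, d1 g x i j = 0 := by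
    filter_upwards [hge.eventually_nhds, hne, htype.2] with x h1 h2 h3 i j
    rw [← class_one θ x h2 h3 i j]
    have : ∀ k, (fun y => g y k) =ᶠ[𝓝 x] fun y => θ y k := fun k => by
      filter_upwards [h1] with y hy
      rw [hy]
    rw [d1, d1, pd_congr (this j), pd_congr (this i)]
  obtain ⟨f, hf, hf0, hfd⟩ := exists_potential g hg x₀ hgd
  have df : Differentiable ℝ f := hf.differentiable (by simp)
  let c : Form2 := fun x i j => exp (-f x) * A x i j
  have hAij : ∀ i j, ContDiff ℝ ∞ fun x => A x i j := fun i j => contDiff_pi.1 (contDiff_pi.1 hA i) j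
  have hE : ContDiff ℝ ∞ fun x => exp (-f x) := hf.neg.exp
  have hc : ContDiff ℝ ∞ c := contDiff_pi.2 fun i => contDiff_pi.2 fun j => hE.mul (hAij i j)
  have hcs : ∀ᶠ x in 𝓝 x₀, ∀ i j, c x i j = - c x j i := by
    filter_upwards [hAe, hWn] with x h1 h2 i j
    change exp (-f x) * A x i j = -(exp (-f x) * A x j i)
    rw [h1, hΩa x h2 i j]; ring
  have hdE : ∀ x i, pd i (fun y => exp (-f y)) x = - (exp (-f x) * pd i f x) := by
    intro x i
    have h1 : HasFDerivAt (fun y => exp (-f y)) (exp (-f x) • (-fderiv ℝ f x)) x :=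
      ((df x).hasFDerivAt.neg).exp
    rw [pd, h1.fderiv]
    simp [pd]
  have hcd : ∀ᶠ x in 𝓝 x₀, ∀ i j k, d2 c x i j k = 0 := by
    filter_upwards [hAe, hAe.eventually_nhds, hWn, hge, hfd] with x h1 h2 h3 h4 h5 i j k
    have hpd : ∀ m i j, pd m (fun y => c y i j) x =
        exp (-f x) * (pd m (fun y => Ω y i j) x - θ x m * Ω x i j) := by
      intro m i j
      have e1 : (fun y => A y i j) =ᶠ[𝓝 x] fun y => Ω y i j := by
        filter_upwards [h2] with y hy
        rw [hy]
      have h6 : pd m (fun y => c y i j) x = exp (-f x) * pd m (fun y => A y i j) x +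
          A x i j * pd m (fun y => exp (-f y)) x := by
        have := fderiv_fun_mul (hE.differentiable (by simp) x) ((hAij i j).differentiable (by simp) x)
        change fderiv ℝ (fun y => exp (-f y) * A y i j) x _ = _
        rw [this]; rfl
      rw [h6, hdE, h5, h4, pd_congr e1, h1]; ring
    have h7 := congrFun (congrFun (congrFun (hθ x h3) i) j) k
    simp only [w12, d2] at h7
    simp only [d2, hpd]
    linear_combination - exp (-f x) * h7
  have hσc : ∀ᶠ x in 𝓝 x₀, ClosedAt (toB c) x := by
    filter_upwards [hcs.eventually_nhds, hcd] with x h1 h2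
    exact toB_closed hc h1 h2
  have hσs : ∀ᶠ x in 𝓝 x₀, SkewAt (toB c) x := by
    filter_upwards [hcs] with x h1
    exact toB_skew h1
  have hcΩ : ∀ᶠ x in 𝓝 x₀, ∀ u v, toB Ω x u v = exp (f x) * toB c x u v := by
    filter_upwards [hAe] with x h1 u v
    rw [toB_apply, toB_apply, Finset.mul_sum]
    refine Finset.sum_congr rfl fun i _ => ?_
    rw [Finset.mul_sum]
    refine Finset.sum_congr rfl fun j _ => ?_
    have : exp (f x) * exp (-f x) = 1 := by rw [← exp_add]; simp
    change _ = exp (f x) * (exp (-f x) * A x i j * u i * v j)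
    rw [h1]
    linear_combination (-(Ω x i j * u i * v j)) * this
  let p : Pt → ℝ := fun x => - exp (-f x)
  have hp : ContDiff ℝ ∞ p := hE.neg
  have hdp : ∀ x u, fderiv ℝ p x u = exp (-f x) * fderiv ℝ f x u := by
    intro x u
    have h1 : HasFDerivAt p (-(exp (-f x) • (-fderiv ℝ f x))) x :=
      (((df x).hasFDerivAt.neg).exp).neg
    rw [h1.fderiv]
    simp
  have hp0 : fderiv ℝ p x₀ ≠ 0 := by
    intro h
    apply htype.1
    ext i
    have h1 := hdp x₀ (Pi.single i 1)
    have h2 := hfd.self_of_nhds i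
    rw [hge.self_of_nhds] at h2
    unfold pd at h2
    rw [h, h2] at h1
    simpa using h1
  obtain ⟨F1, F2, q, h1, h2, h3, h10, h20, h30, hF⟩ := darboux_four (by simp) (toB c) (toB_contDiff hc) x₀
    hσc hσs (fun u hu => toB_nondeg (hΩa x₀ hx₀) (hΩr x₀ hx₀) u (fun v => by
      rw [hcΩ.self_of_nhds, hu, mul_zero])) p hp hp0
  refine ⟨F1, F2, f, q, h1, h2, hf, h3, h10, h20, hf0, h30, ?_⟩
  filter_upwards [hcΩ, hF] with x e1 e2 u v
  have : exp (f x) * exp (-f x) = 1 := by rw [← exp_add]; simp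
  have dq := h3.differentiable (by simp) x
  rw [e1, e2, wdg_apply (hp.differentiable (by simp) x) dq, wdg_apply (df x) dq, hdp, hdp]
  linear_combination (fderiv ℝ f x u * fderiv ℝ q x v - fderiv ℝ q x u * fderiv ℝ f x v) * this

theorem normal_form_main (W : Set Pt) (hW : IsOpen W) (x₀ : Pt) (hx₀ : x₀ ∈ W)
    (Ω : Form2) (hΩs : ContDiffOn ℝ ∞ Ω W)
    (hΩa : ∀ x ∈ W, ∀ i j, Ω x i j = - Ω x j i)
    (hΩr : ∀ x ∈ W, w22 Ω Ω x ≠ 0)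
    (θ : Form1) (hθs : ContDiffOn ℝ ∞ θ W)
    (hθ : ∀ x ∈ W, w12 θ Ω x = d2 Ω x)
    (htype : IsTypeAt θ 1 x₀) :
    ∃ (U V : Set Pt) (φ ψ : Pt → Pt),
      IsOpen U ∧ IsOpen V ∧ (0 : Pt) ∈ U ∧ x₀ ∈ V ∧ V ⊆ W ∧ φ 0 = x₀ ∧
      Set.MapsTo φ U V ∧ Set.MapsTo ψ V U ∧
      (∀ u ∈ U, ψ (φ u) = u) ∧ (∀ y ∈ V, φ (ψ y) = y) ∧
      ContDiffOn ℝ ∞ φ U ∧ ContDiffOn ℝ ∞ ψ V ∧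
      ∀ u ∈ U, ∀ i j, pull2 φ Ω u i j = Real.exp (u 2) * dxw 0 1 i j + dxw 2 3 i j := by
  obtain ⟨F1, F2, f, q, h1, h2, h3, h4, h10, h20, h30, h40, hF⟩ :=
    normal_form_functions W hW x₀ hx₀ Ω hΩs hΩa hΩr θ hθs hθ htype
  have D1 : Differentiable ℝ F1 := h1.differentiable (by simp)
  have D2 : Differentiable ℝ F2 := h2.differentiable (by simp)
  have D3 : Differentiable ℝ f := h3.differentiable (by simp)
  have D4 : Differentiable ℝ q := h4.differentiable (by simp)
  let G : Pt → Pt := fun x => ![F1 x, F2 x, f x, q x]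
  have hG : ContDiff ℝ ∞ G := by
    rw [contDiff_pi]
    intro i
    fin_cases i
    · exact h1
    · exact h2
    · exact h3
    · exact h4
  have DG : Differentiable ℝ G := hG.differentiable (by simp)
  have hcomp : ∀ x u i, fderiv ℝ G x u i = fderiv ℝ (fun y => G y i) x u := by
    intro x u i
    have h := hasFDerivAt_pi'.1 (DG x).hasFDerivAt i
    rw [h.fderiv]; rfl
  have c0 : ∀ x u, fderiv ℝ F1 x u = fderiv ℝ G x u 0 := fun x u => (hcomp x u 0).symm
  have c1 : ∀ x u, fderiv ℝ F2 x u = fderiv ℝ G x u 1 := fun x u => (hcomp x u 1).symm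
  have c2 : ∀ x u, fderiv ℝ f x u = fderiv ℝ G x u 2 := fun x u => (hcomp x u 2).symm
  have c3 : ∀ x u, fderiv ℝ q x u = fderiv ℝ G x u 3 := fun x u => (hcomp x u 3).symm
  have hF' : ∀ᶠ x in 𝓝 x₀, ∀ u v, toB Ω x u v = exp (G x 2) *
      (fderiv ℝ G x u 0 * fderiv ℝ G x v 1 - fderiv ℝ G x u 1 * fderiv ℝ G x v 0) +
      (fderiv ℝ G x u 2 * fderiv ℝ G x v 3 - fderiv ℝ G x u 3 * fderiv ℝ G x v 2) := by
    filter_upwards [hF] with x hx u v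
    rw [hx, wdg_apply (D1 x) (D2 x), wdg_apply (D3 x) (D4 x)]
    simp only [c0, c1, c2, c3]
    rfl
  have hinj : Function.Injective (fderiv ℝ G x₀ : Pt →ₗ[ℝ] Pt) := by
    rw [injective_iff_map_eq_zero]
    intro u hu
    have hu' : fderiv ℝ G x₀ u = 0 := hu
    refine toB_nondeg (hΩa x₀ hx₀) (hΩr x₀ hx₀) u fun v => ?_
    rw [hF'.self_of_nhds, hu']
    simp
  let S : Pt ≃L[ℝ] Pt := (LinearMap.linearEquivOfInjective _ hinj rfl).toContinuousLinearEquiv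
  have hS : HasFDerivAt G (S : Pt →L[ℝ] Pt) x₀ := (DG x₀).hasFDerivAt
  obtain ⟨e, he0, heW, heG, hes⟩ := smooth_inverse hG S hS
    (W := {x | x ∈ W ∧ ∀ u v, toB Ω x u v = exp (G x 2) *
      (fderiv ℝ G x u 0 * fderiv ℝ G x v 1 - fderiv ℝ G x u 1 * fderiv ℝ G x v 0) +
      (fderiv ℝ G x u 2 * fderiv ℝ G x v 3 - fderiv ℝ G x u 3 * fderiv ℝ G x v 2)})
    (Filter.Eventually.and (hW.mem_nhds hx₀) hF')
  have hG0 : G x₀ = 0 := by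
    ext i
    fin_cases i
    · exact h10
    · exact h20
    · exact h30
    · exact h40
  have he0' : e x₀ = 0 := by rw [heG, hG0]
  refine ⟨e.target, e.source, e.symm, e, e.open_target, e.open_source, ?_, he0, fun x hx => (heW hx).1,
    ?_, fun u hu => e.map_target hu, fun x hx => e.map_source hx, fun u hu => e.right_inv hu,
    fun x hx => e.left_inv hx, hes, ?_, ?_⟩
  · rw [← he0']; exact e.map_source he0
  · rw [← he0']; exact e.left_inv he0
  · rw [heG]; exact hG.contDiffOn
  · intro u hu i j
    have hx := e.map_target hu
    set x := e.symm u with hxd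
    have hGx : G x = u := by rw [← heG]; exact e.right_inv hu
    have dφ : HasFDerivAt e.symm (fderiv ℝ e.symm u) u :=
      ((hes.differentiableOn (by simp) u hu).differentiableAt (e.open_target.mem_nhds hu)).hasFDerivAt
    have hpd : ∀ i a, pd i (fun y => e.symm y a) u = fderiv ℝ e.symm u (Pi.single i 1) a := by
      intro i a
      have h := hasFDerivAt_pi'.1 dφ a
      rw [pd, h.fderiv]; rfl
    have d2 : HasFDerivAt (G ∘ e.symm) ((fderiv ℝ G x).comp (fderiv ℝ e.symm u)) u :=
      (DG x).hasFDerivAt.comp u dφ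
    have d3 : HasFDerivAt (G ∘ e.symm) (ContinuousLinearMap.id ℝ Pt) u := by
      refine (hasFDerivAt_id u).congr_of_eventuallyEq ?_
      filter_upwards [e.open_target.mem_nhds hu] with y hy
      change G (e.symm y) = y
      rw [← heG]; exact e.right_inv hy
    have hid : ∀ w, fderiv ℝ G x (fderiv ℝ e.symm u w) = w := fun w =>
      congrArg (fun L : Pt →L[ℝ] Pt => L w) (d2.unique d3)
    have e1 : pull2 e.symm Ω u i j =
        toB Ω x (fderiv ℝ e.symm u (Pi.single i 1)) (fderiv ℝ e.symm u (Pi.single j 1)) := by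
      rw [toB_apply, pull2]
      simp only [hpd]
      rfl
    rw [e1, (heW hx).2, hid, hid, hGx]
    fin_cases i <;> fin_cases j <;> simp [dxw]

end final

end helpers

/-- Theorem `type1`. A germ of a rank-4 2-form of type 1 at `x₀` has,
in suitable local coordinates centred at `x₀`, the normal form
`Ω = exp(x³) dx¹∧dx² + dx³∧dx⁴`. -/
theorem type1_normal_form (W : Set Pt) (hW : IsOpen W) (x₀ : Pt) (hx₀ : x₀ ∈ W)
    (Ω : Form2) (hΩs : ContDiffOn ℝ (⊤ : ℕ∞) Ω W)
    (hΩa : ∀ x ∈ W, ∀ i j, Ω x i j = - Ω x j i)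
    (hΩr : ∀ x ∈ W, w22 Ω Ω x ≠ 0)
    (ω : Form1) (hωs : ContDiffOn ℝ (⊤ : ℕ∞) ω W)
    (hω : ∀ x ∈ W, w12 ω Ω x = d2 Ω x)
    (htype : IsTypeAt ω 1 x₀) :
    ∃ (U V : Set Pt) (φ ψ : Pt → Pt),
      IsOpen U ∧ IsOpen V ∧ (0 : Pt) ∈ U ∧ x₀ ∈ V ∧ V ⊆ W ∧ φ 0 = x₀ ∧
      Set.MapsTo φ U V ∧ Set.MapsTo ψ V U ∧
      (∀ u ∈ U, ψ (φ u) = u) ∧ (∀ y ∈ V, φ (ψ y) = y) ∧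
      ContDiffOn ℝ (⊤ : ℕ∞) φ U ∧ ContDiffOn ℝ (⊤ : ℕ∞) ψ V ∧
      ∀ u ∈ U, ∀ i j, pull2 φ Ω u i j = Real.exp (u 2) * dxw 0 1 i j + dxw 2 3 i j := by
  exact normal_form_main W hW x₀ hx₀ Ω hΩs hΩa hΩr ω hωs hω htype
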